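/- arXiv:1903.01051 — 7 statements merged into one kernel-verified Lean document; each statement's English description precedes it below -/
import Mathlib

section
/- For every real number p ≥ 2.4, one has 4·(1/8)^(1/p) + 6·(1/4)^(1/p) + 4·(3/8)^(1/p) + (1/2)^(1/p) > 8. -/
/-- A rational certificate `q ^ 12 ≤ a ^ 5` bounds `a ^ (1 / p)` from below for `p ≥ 12 / 5`. -/
theorem le_rpow_one_div_of_pow_le_pow {a q p : ℝ} (ha : 0 < a) (ha1 : a ≤ 1)
    (hp : 2.4 ≤ p) (h : q ^ 12 ≤ a ^ 5) : q ≤ a ^ (1 / p) := by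
  have hexp : 1 / p ≤ (5 / 12 : ℝ) := by
    rw [div_le_div_iff₀ (by linarith) (by norm_num)]
    linarith
  refine le_trans ?_ (Real.rpow_le_rpow_of_exponent_ge ha ha1 hexp)
  refine le_of_pow_le_pow_left₀ (n := 12) (by norm_num) (by positivity) (h.trans_eq ?_)
  rw [← Real.rpow_mul_natCast ha.le, ← Real.rpow_natCast]
  norm_num

theorem wasserstein_large_p_counterexample_inequality (p : ℝ) (hp : 2.4 ≤ p) :
    4 * ((1 / 8 : ℝ)) ^ (1 / p) + 6 * ((1 / 4 : ℝ)) ^ (1 / p)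
      + 4 * ((3 / 8 : ℝ)) ^ (1 / p) + ((1 / 2 : ℝ)) ^ (1 / p) > 8 := by
  have h₁ : (2 / 5 : ℝ) ≤ (1 / 8 : ℝ) ^ (1 / p) := by
    apply le_rpow_one_div_of_pow_le_pow <;> first | exact hp | norm_num
  have h₂ : (11 / 20 : ℝ) ≤ (1 / 4 : ℝ) ^ (1 / p) := by
    apply le_rpow_one_div_of_pow_le_pow <;> first | exact hp | norm_num
  have h₃ : (13 / 20 : ℝ) ≤ (3 / 8 : ℝ) ^ (1 / p) := by
    apply le_rpow_one_div_of_pow_le_pow <;> first | exact hp | norm_num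
  have h₄ : (7 / 10 : ℝ) ≤ (1 / 2 : ℝ) ^ (1 / p) := by
    apply le_rpow_one_div_of_pow_le_pow <;> first | exact hp | norm_num
  linarith
end

section
/- For every real number p ≥ 2.4, one has 4 + 6·2^(1/p) + 4·3^(1/p) + 4^(1/p) > 8·8^(1/p). -/
theorem eight_mul_pow_six_lt {y : ℝ} (hy0 : 0 < y) (hy : y ≤ 1.16) :
    8 * y ^ 6 < 4 + 6 * y ^ 2 + 4 * y ^ 3 + y ^ 4 := by
  have h2 : y ^ 2 ≤ 1.16 ^ 2 := by gcongr
  have h3 : y ^ 3 ≤ 1.16 ^ 3 := by gcongr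
  have h4 : y ^ 4 ≤ 1.16 ^ 4 := by gcongr
  have h6 : y ^ 6 ≤ 1.16 ^ 6 := by gcongr
  have k2 : y ^ 2 * y ^ 4 ≤ y ^ 2 * 1.16 ^ 4 := by gcongr
  have k3 : y ^ 3 * y ^ 3 ≤ y ^ 3 * 1.16 ^ 3 := by gcongr
  have k4 : y ^ 4 * y ^ 2 ≤ y ^ 4 * 1.16 ^ 2 := by gcongr
  ring_nf at k2 k3 k4 h6 ⊢
  linarith

theorem wasserstein_large_p_within_vs_between (p : ℝ) (hp : 2.4 ≤ p) :
    4 + 6 * (2 : ℝ) ^ (1 / p) + 4 * (3 : ℝ) ^ (1 / p) + (4 : ℝ) ^ (1 / p)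
      > 8 * (8 : ℝ) ^ (1 / p) := by
  have hp0 : 0 < p := by linarith
  have hs0 : 0 ≤ 1 / p := by positivity
  have hs : 1 / p ≤ 5 / 12 := by
    rw [div_le_div_iff₀ hp0 (by norm_num)]
    linarith
  set s := 1 / p
  set y : ℝ := 2 ^ (s / 2) with hy
  have hy0 : 0 < y := by positivity
  have hpow (n : ℕ) : y ^ n = 2 ^ (s / 2 * n) := by
    rw [hy, Real.rpow_mul_natCast (by norm_num)]
  have h2 : (2 : ℝ) ^ s = y ^ 2 := by
    rw [hpow]
    congr 1
    push_cast
    ring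
  have h4 : (4 : ℝ) ^ s = y ^ 4 := by
    rw [show (4 : ℝ) = 2 * 2 by norm_num, Real.mul_rpow (by norm_num) (by norm_num), h2]
    ring
  have h8 : (8 : ℝ) ^ s = y ^ 6 := by
    rw [show (8 : ℝ) = 4 * 2 by norm_num, Real.mul_rpow (by norm_num) (by norm_num), h4, h2]
    ring
  have h3 : y ^ 3 ≤ (3 : ℝ) ^ s := by
    refine le_of_pow_le_pow_left₀ two_ne_zero (by positivity) ?_
    calc (y ^ 3) ^ 2 = (8 : ℝ) ^ s := by rw [h8]; ring
      _ ≤ (3 * 3 : ℝ) ^ s := Real.rpow_le_rpow (by norm_num) (by norm_num) hs0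
      _ = ((3 : ℝ) ^ s) ^ 2 := by rw [Real.mul_rpow (by norm_num) (by norm_num), sq]
  have hy24 : y ^ 24 ≤ 2 ^ 5 := by
    rw [hpow, ← Real.rpow_natCast 2 5]
    exact Real.rpow_le_rpow_of_exponent_le (by norm_num) (by push_cast; linarith)
  have hy1 : y ≤ 1.16 :=
    le_of_pow_le_pow_left₀ (n := 24) (by norm_num) (by norm_num) (hy24.trans (by norm_num))
  rw [h2, h4, h8]
  linarith [eight_mul_pow_six_lt hy0 hy1]
end

section
/- Define the tent function Λ_{a,b} : ℝ → ℝ by Λ_{a,b}(t) = max(0, min(t−a, b−t)) for reals a < b. Let F₁ = Λ_{0,1} + Λ_{3,4}, F₂ = Λ_{1,2} + Λ_{2,3}, G₁ = Λ_{0,1} + Λ_{1,2}, G₂ = Λ_{2,3} + Λ_{3,4} (pointwise sums). Then ∫_ℝ |F₁ − F₂| = ∫_ℝ |G₁ − G₂| = 1 and ∫_ℝ |F_i − G_j| = 1/2 for all i, j ∈ {1,2}; consequently, with weights α = (1, 1, −1, −1) (which sum to 0 and are not all zero) assigned to (F₁, F₂, G₁, G₂), the sum Σ_{i,j} α_i α_j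 d(·,·) of weighted pairwise L¹ distances equals 0. -/
open MeasureTheory

/-- The tent (triangle) function `Λ_{a,b}(t) = max(0, min(t − a, b − t))`. -/
def tent (a b : ℝ) : ℝ → ℝ := fun t => max 0 (min (t - a) (b - t))

/-- The `L¹` distance between two real functions. -/
noncomputable def dL1 (f g : ℝ → ℝ) : ℝ := ∫ t : ℝ, |f t - g t|

theorem tent_nonneg (a b t : ℝ) : 0 ≤ tent a b t := le_max_left _ _

theorem tent_eq_zero_of_le {a b t : ℝ} (h : t ≤ a) : tent a b t = 0 :=
  max_eq_left ((min_le_left _ _).trans (by linarith))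

theorem tent_eq_zero_of_ge {a b t : ℝ} (h : b ≤ t) : tent a b t = 0 :=
  max_eq_left ((min_le_right _ _).trans (by linarith))

theorem continuous_tent (a b : ℝ) : Continuous (tent a b) := by
  unfold tent
  fun_prop

theorem tent_support_subset (a b : ℝ) : Function.support (tent a b) ⊆ Set.Ioc a b := by
  intro t ht
  by_contra h
  rw [Set.mem_Ioc, not_and_or, not_lt, not_le] at h
  exact ht (h.elim tent_eq_zero_of_le fun h => tent_eq_zero_of_ge h.le)

theorem integrable_tent (a b : ℝ) : Integrable (tent a b) := by
  refine (continuous_tent a b).integrable_of_hasCompactSupport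
    (HasCompactSupport.intro (isCompact_Icc (a := a) (b := b)) fun t ht => ?_)
  by_contra h
  exact ht (Set.Ioc_subset_Icc_self (tent_support_subset a b h))

theorem integral_tent {a b : ℝ} (hab : a ≤ b) : ∫ t, tent a b t = (b - a) ^ 2 / 4 := by
  rw [← intervalIntegral.integral_eq_integral_of_support_subset (tent_support_subset a b),
    ← intervalIntegral.integral_add_adjacent_intervals (b := (a + b) / 2)
      ((continuous_tent a b).intervalIntegrable _ _) ((continuous_tent a b).intervalIntegrable _ _)]
  have left : ∫ t in a..((a + b) / 2), tent a b t = ∫ t in a..((a + b) / 2), (t - a) := by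
    refine intervalIntegral.integral_congr fun t ht => ?_
    rw [Set.uIcc_of_le (by linarith)] at ht
    have h : t - a ≤ b - t := by linarith [ht.2]
    simp [tent, min_eq_left h, ht.1]
  have right : ∫ t in ((a + b) / 2)..b, tent a b t = ∫ t in ((a + b) / 2)..b, (b - t) := by
    refine intervalIntegral.integral_congr fun t ht => ?_
    rw [Set.uIcc_of_le (by linarith)] at ht
    have h : b - t ≤ t - a := by linarith [ht.1]
    simp [tent, min_eq_right h, ht.2]
  rw [left, right, intervalIntegral.integral_sub (by simp) (by simp),
    intervalIntegral.integral_sub (by simp) (by simp)]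
  simp only [integral_id, intervalIntegral.integral_const, smul_eq_mul]
  ring

theorem tent_eq_zero_or_tent_eq_zero {a b c d : ℝ} (h : b ≤ c) (t : ℝ) :
    tent a b t = 0 ∨ tent c d t = 0 :=
  (le_total t c).elim (fun ht => .inr (tent_eq_zero_of_le ht))
    fun ht => .inl (tent_eq_zero_of_ge (h.trans ht))

theorem dL1_comm (f g : ℝ → ℝ) : dL1 f g = dL1 g f := by
  simp only [dL1, abs_sub_comm]

theorem dL1_self (f : ℝ → ℝ) : dL1 f f = 0 := by
  simp [dL1]

/-- The distance between functions whose difference is that of two disjoint tents. -/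
theorem dL1_eq_of_sub_eq_tent_sub_tent {f g : ℝ → ℝ} {a b c d : ℝ}
    (hab : a ≤ b) (hbc : b ≤ c) (hcd : c ≤ d)
    (h : ∀ t, f t - g t = tent a b t - tent c d t) :
    dL1 f g = (b - a) ^ 2 / 4 + (d - c) ^ 2 / 4 := by
  have key (t : ℝ) : |f t - g t| = tent a b t + tent c d t := by
    rw [h]
    rcases tent_eq_zero_or_tent_eq_zero (a := a) (d := d) hbc t with h0 | h0 <;>
      simp [h0, abs_of_nonneg, tent_nonneg]
  simp only [dL1, key]
  rw [integral_add (integrable_tent a b) (integrable_tent c d), integral_tent hab,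
    integral_tent hcd]

/-- Two functions whose difference has the sum of the four unit tents on `[0, 4]` as its
absolute value are at distance `1`. -/
theorem dL1_eq_one_of_abs_sub_eq {f g : ℝ → ℝ}
    (h : ∀ t, |f t - g t| = tent 0 1 t + tent 1 2 t + (tent 2 3 t + tent 3 4 t)) :
    dL1 f g = 1 := by
  simp only [dL1, h]
  rw [integral_add (by exact (integrable_tent 0 1).add (integrable_tent 1 2))
      (by exact (integrable_tent 2 3).add (integrable_tent 3 4)),
    integral_add (integrable_tent 0 1) (integrable_tent 1 2),
    integral_add (integrable_tent 2 3) (integrable_tent 3 4), integral_tent (by norm_num),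
    integral_tent (by norm_num), integral_tent (by norm_num), integral_tent (by norm_num)]
  norm_num

theorem abs_add_sub_add_eq_of_disjoint {x y z w : ℝ} (hx : 0 ≤ x) (hy : 0 ≤ y) (hz : 0 ≤ z)
    (hw : 0 ≤ w) (hxz : x = 0 ∨ z = 0) (hxw : x = 0 ∨ w = 0) (hyz : y = 0 ∨ z = 0)
    (hyw : y = 0 ∨ w = 0) : |x + y - (z + w)| = x + y + (z + w) := by
  grind

theorem landscapes_L1_not_strict_negative_type_witness :
    let F₁ : ℝ → ℝ := fun t => tent 0 1 t + tent 3 4 t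
    let F₂ : ℝ → ℝ := fun t => tent 1 2 t + tent 2 3 t
    let G₁ : ℝ → ℝ := fun t => tent 0 1 t + tent 1 2 t
    let G₂ : ℝ → ℝ := fun t => tent 2 3 t + tent 3 4 t
    let fs : Fin 4 → ℝ → ℝ := ![F₁, F₂, G₁, G₂]
    let α : Fin 4 → ℝ := ![1, 1, -1, -1]
    dL1 F₁ F₂ = 1 ∧ dL1 G₁ G₂ = 1 ∧
    (∀ i : Fin 2, ∀ j : Fin 2, dL1 (![F₁, F₂] i) (![G₁, G₂] j) = 1 / 2) ∧
    (∑ i : Fin 4, α i = 0) ∧ α ≠ 0 ∧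
    (∑ i : Fin 4, ∑ j : Fin 4, α i * α j * dL1 (fs i) (fs j)) = 0 := by
  intro F₁ F₂ G₁ G₂ fs α
  have hF : dL1 F₁ F₂ = 1 := dL1_eq_one_of_abs_sub_eq fun t => by
    rw [abs_add_sub_add_eq_of_disjoint (tent_nonneg ..) (tent_nonneg ..) (tent_nonneg ..)
      (tent_nonneg ..) (tent_eq_zero_or_tent_eq_zero (by norm_num) t)
      (tent_eq_zero_or_tent_eq_zero (by norm_num) t)
      (tent_eq_zero_or_tent_eq_zero (by norm_num) t).symm
      (tent_eq_zero_or_tent_eq_zero (by norm_num) t).symm]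
    ring
  have hG : dL1 G₁ G₂ = 1 := dL1_eq_one_of_abs_sub_eq fun t =>
    abs_add_sub_add_eq_of_disjoint (tent_nonneg ..) (tent_nonneg ..) (tent_nonneg ..)
      (tent_nonneg ..) (tent_eq_zero_or_tent_eq_zero (by norm_num) t)
      (tent_eq_zero_or_tent_eq_zero (by norm_num) t)
      (tent_eq_zero_or_tent_eq_zero (by norm_num) t)
      (tent_eq_zero_or_tent_eq_zero (by norm_num) t)
  have h₁₁ : dL1 F₁ G₁ = 1 / 2 := by
    rw [dL1_comm, dL1_eq_of_sub_eq_tent_sub_tent (a := 1) (b := 2) (c := 3) (d := 4)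
      (by norm_num) (by norm_num) (by norm_num) fun t => by simp only [F₁, G₁]; ring]
    norm_num
  have h₁₂ : dL1 F₁ G₂ = 1 / 2 := by
    rw [dL1_eq_of_sub_eq_tent_sub_tent (a := 0) (b := 1) (c := 2) (d := 3)
      (by norm_num) (by norm_num) (by norm_num) fun t => by simp only [F₁, G₂]; ring]
    norm_num
  have h₂₁ : dL1 F₂ G₁ = 1 / 2 := by
    rw [dL1_comm, dL1_eq_of_sub_eq_tent_sub_tent (a := 0) (b := 1) (c := 2) (d := 3)
      (by norm_num) (by norm_num) (by norm_num) fun t => by simp only [F₂, G₁]; ring]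
    norm_num
  have h₂₂ : dL1 F₂ G₂ = 1 / 2 := by
    rw [dL1_eq_of_sub_eq_tent_sub_tent (a := 1) (b := 2) (c := 3) (d := 4)
      (by norm_num) (by norm_num) (by norm_num) fun t => by simp only [F₂, G₂]; ring]
    norm_num
  refine ⟨hF, hG, ?_, ?_, ?_, ?_⟩
  · intro i j
    fin_cases i <;> fin_cases j
    exacts [h₁₁, h₁₂, h₂₁, h₂₂]
  · simp [α, Fin.sum_univ_four]
  · intro h
    simpa [α] using congrFun h 0
  · have hs (i j : Fin 4) : dL1 (fs i) (fs j) =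
        !![0, 1, 1 / 2, 1 / 2; 1, 0, 1 / 2, 1 / 2; 1 / 2, 1 / 2, 0, 1; 1 / 2, 1 / 2, 1, 0] i j := by
      fin_cases i <;> fin_cases j
      exacts [dL1_self _, hF, h₁₁, h₁₂, (dL1_comm ..).trans hF, dL1_self _, h₂₁, h₂₂,
        (dL1_comm ..).trans h₁₁, (dL1_comm ..).trans h₂₁, dL1_self _, hG,
        (dL1_comm ..).trans h₁₂, (dL1_comm ..).trans h₂₂, (dL1_comm ..).trans hG, dL1_self _]
    simp [hs, Fin.sum_univ_four, α]
    norm_num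
end

section
/- Let H be a separable real Hilbert space and let μ₁, μ₂ be Borel probability measures on H with finite first moment (i.e. x ↦ ‖x − x₀‖ is integrable for every x₀). Then 2∫∫ ‖x − y‖ dμ₁(x) dμ₂(y) − ∫∫ ‖x − y‖ dμ₁(x) dμ₁(y) − ∫∫ ‖x − y‖ dμ₂(x) dμ₂(y) ≥ 0, with equality if and only if μ₁ = μ₂. -/
open MeasureTheory ProbabilityTheory Filter Topology
open scoped RealInnerProductSpace NNReal

lemma integrable_integral_mul_integral {E X : Type*} [MeasurableSpace E] [MeasurableSpace X]
    {γ : Measure E} [IsFiniteMeasure γ] {f : E → X → ℝ} (hf : Measurable (Function.uncurry f))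
    (hb : ∀ g x, |f g x| ≤ 1) (μ ν : Measure X) [IsFiniteMeasure μ] [IsFiniteMeasure ν] :
    Integrable (fun g ↦ (∫ x, f g x ∂μ) * (∫ x, f g x ∂ν)) γ := by
  have key (ρ : Measure X) [IsFiniteMeasure ρ] (g : E) : ‖∫ x, f g x ∂ρ‖ ≤ ρ.real Set.univ := by
    simpa using norm_integral_le_of_norm_le_const (μ := ρ) (f := f g) (ae_of_all _ (hb g))
  refine Integrable.of_bound ?_ (μ.real Set.univ * ν.real Set.univ) (ae_of_all _ fun g ↦ ?_)
  · exact (hf.stronglyMeasurable.integral_prod_right.mul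
      hf.stronglyMeasurable.integral_prod_right).aestronglyMeasurable
  · rw [norm_mul]
    exact mul_le_mul (key μ g) (key ν g) (norm_nonneg _) measureReal_nonneg

section GaussianPairing

variable {H : Type*} [NormedAddCommGroup H] [MeasurableSpace H]

/-- The double integral of the Gaussian kernel `exp (-c² ‖x - y‖² / 2)` against `μ ⊗ ν`. -/
noncomputable def gaussianPairing (c : ℝ) (μ ν : Measure H) : ℝ :=
  ∫ z, Real.exp (-(c * ‖z.1 - z.2‖) ^ 2 / 2) ∂(μ.prod ν)

lemma exp_neg_sq_div_two_le_one (a : ℝ) : Real.exp (-a ^ 2 / 2) ≤ 1 :=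
  Real.exp_le_one_iff.2 (by nlinarith [sq_nonneg a])

lemma gaussianPairing_comm (c : ℝ) (μ ν : Measure H) [IsFiniteMeasure μ] [IsFiniteMeasure ν] :
    gaussianPairing c μ ν = gaussianPairing c ν μ := by
  unfold gaussianPairing
  rw [← integral_prod_swap]
  simp [norm_sub_rev]

variable [BorelSpace H] [SecondCountableTopology H]

lemma integrable_gaussianKernel (c : ℝ) (ρ : Measure (H × H)) [IsFiniteMeasure ρ] :
    Integrable (fun z ↦ Real.exp (-(c * ‖z.1 - z.2‖) ^ 2 / 2)) ρ := by
  refine Integrable.of_bound (by fun_prop) 1 (ae_of_all _ fun z ↦ ?_)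
  rw [Real.norm_eq_abs, Real.abs_exp]
  exact exp_neg_sq_div_two_le_one _

lemma gaussianPairing_add_smul_left (c : ℝ) (s : ℝ≥0) (μ ρ ν : Measure H) [IsFiniteMeasure μ]
    [IsFiniteMeasure ρ] [IsFiniteMeasure ν] :
    gaussianPairing c (μ + s • ρ) ν = gaussianPairing c μ ν + s * gaussianPairing c ρ ν := by
  unfold gaussianPairing
  have h : (s • ρ).prod ν = s • ρ.prod ν := Measure.prod_smul_left s
  rw [Measure.add_prod, h, integral_add_measure (integrable_gaussianKernel c _)
    (integrable_gaussianKernel c _), integral_smul_nnreal_measure]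
  rfl

lemma gaussianPairing_dirac_left (c : ℝ) (x : H) (μ : Measure H) [IsFiniteMeasure μ] :
    gaussianPairing c (Measure.dirac x) μ = ∫ y, Real.exp (-(c * ‖x - y‖) ^ 2 / 2) ∂μ := by
  rw [gaussianPairing, integral_prod _ (integrable_gaussianKernel c _), integral_dirac]

end GaussianPairing

section GaussianKernel

variable {H : Type*} [NormedAddCommGroup H] [InnerProductSpace ℝ H]

lemma integral_cos_inner_stdGaussian {E : Type*} [NormedAddCommGroup E] [InnerProductSpace ℝ E]
    [FiniteDimensional ℝ E] [MeasurableSpace E] [BorelSpace E] (t : E) :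
    ∫ g, Real.cos ⟪g, t⟫ ∂(stdGaussian E) = Real.exp (-‖t‖ ^ 2 / 2) := by
  have h := congrArg Complex.re (charFun_stdGaussian t)
  rw [charFun_apply, ← RCLike.re_eq_complex_re, ← integral_re] at h
  · simp only [RCLike.re_eq_complex_re, Complex.exp_ofReal_mul_I_re] at h
    rw [h]
    exact_mod_cast Complex.ofReal_re _
  · refine Integrable.of_bound (by fun_prop) 1 (ae_of_all _ fun x ↦ ?_)
    simp [Complex.norm_exp_ofReal_mul_I]

variable [MeasurableSpace H] [BorelSpace H] [SecondCountableTopology H]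

lemma integral_exp_neg_norm_sq_finiteDimensional {E : Type*} [NormedAddCommGroup E]
    [InnerProductSpace ℝ E] [FiniteDimensional ℝ E] [MeasurableSpace E] [BorelSpace E]
    (T : H →L[ℝ] E) (μ ν : Measure H) [IsFiniteMeasure μ] [IsFiniteMeasure ν] :
    ∫ z, Real.exp (-‖T (z.1 - z.2)‖ ^ 2 / 2) ∂(μ.prod ν) =
      ∫ g, ((∫ x, Real.cos ⟪g, T x⟫ ∂μ) * (∫ x, Real.cos ⟪g, T x⟫ ∂ν) +
        (∫ x, Real.sin ⟪g, T x⟫ ∂μ) * (∫ x, Real.sin ⟪g, T x⟫ ∂ν)) ∂(stdGaussian E) := by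
  simp_rw [← integral_cos_inner_stdGaussian]
  rw [integral_integral_swap]
  · congr with g
    rw [← integral_prod_mul, ← integral_prod_mul, ← integral_add]
    · simp [inner_sub_right, Real.cos_sub]
    · refine Integrable.of_bound (by fun_prop) 1 (ae_of_all _ fun z ↦ ?_)
      rw [norm_mul]
      exact mul_le_one₀ (Real.abs_cos_le_one _) (norm_nonneg _) (Real.abs_cos_le_one _)
    · refine Integrable.of_bound (by fun_prop) 1 (ae_of_all _ fun z ↦ ?_)
      rw [norm_mul]
      exact mul_le_one₀ (Real.abs_sin_le_one _) (norm_nonneg _) (Real.abs_sin_le_one _)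
  · refine Integrable.of_bound (by fun_prop) 1 (ae_of_all _ fun z ↦ ?_)
    exact Real.abs_cos_le_one _

lemma exp_neg_norm_sq_energy_nonneg_finiteDimensional {E : Type*} [NormedAddCommGroup E]
    [InnerProductSpace ℝ E] [FiniteDimensional ℝ E] [MeasurableSpace E] [BorelSpace E]
    (T : H →L[ℝ] E) (μ ν : Measure H) [IsFiniteMeasure μ] [IsFiniteMeasure ν] :
    0 ≤ ∫ z, Real.exp (-‖T (z.1 - z.2)‖ ^ 2 / 2) ∂(μ.prod μ) -
      2 * ∫ z, Real.exp (-‖T (z.1 - z.2)‖ ^ 2 / 2) ∂(μ.prod ν) +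
      ∫ z, Real.exp (-‖T (z.1 - z.2)‖ ^ 2 / 2) ∂(ν.prod ν) := by
  simp_rw [integral_exp_neg_norm_sq_finiteDimensional]
  have hi (μ ν : Measure H) [IsFiniteMeasure μ] [IsFiniteMeasure ν] :
      Integrable (fun g ↦ (∫ x, Real.cos ⟪g, T x⟫ ∂μ) * (∫ x, Real.cos ⟪g, T x⟫ ∂ν) +
        (∫ x, Real.sin ⟪g, T x⟫ ∂μ) * (∫ x, Real.sin ⟪g, T x⟫ ∂ν)) (stdGaussian E) :=
    (integrable_integral_mul_integral (f := fun g x ↦ Real.cos ⟪g, T x⟫)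
      (by simp only [Function.uncurry_def]; fun_prop) (fun _ _ ↦ Real.abs_cos_le_one _) μ ν).add
    (integrable_integral_mul_integral (f := fun g x ↦ Real.sin ⟪g, T x⟫)
      (by simp only [Function.uncurry_def]; fun_prop) (fun _ _ ↦ Real.abs_sin_le_one _) μ ν)
  rw [← integral_const_mul, ← integral_sub (hi μ μ) ((hi μ ν).const_mul 2),
    ← integral_add ?_ (hi ν ν)]
  · refine integral_nonneg fun g ↦ ?_
    simp only [Pi.zero_apply]
    nlinarith [sq_nonneg ((∫ x, Real.cos ⟪g, T x⟫ ∂μ) - ∫ x, Real.cos ⟪g, T x⟫ ∂ν),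
      sq_nonneg ((∫ x, Real.sin ⟪g, T x⟫ ∂μ) - ∫ x, Real.sin ⟪g, T x⟫ ∂ν)]
  · exact (hi μ μ).sub ((hi μ ν).const_mul 2)

/-- The Gaussian kernel is positive definite, integrated against the signed measure `μ - ν`. -/
lemma gaussianPairing_energy_nonneg (c : ℝ) (μ ν : Measure H)
    [IsFiniteMeasure μ] [IsFiniteMeasure ν] :
    0 ≤ gaussianPairing c μ μ - 2 * gaussianPairing c μ ν + gaussianPairing c ν ν := by
  let U : ℕ → Submodule ℝ H :=
    fun n ↦ Submodule.span ℝ (TopologicalSpace.denseSeq H '' Set.Iic n)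
  have hfd (n : ℕ) : FiniteDimensional ℝ (U n) :=
    FiniteDimensional.span_of_finite ℝ ((Set.finite_Iic n).image _)
  have hmono : Monotone U := fun m n hmn ↦
    Submodule.span_mono (Set.image_mono (Set.Iic_subset_Iic.2 hmn))
  have htop : ⊤ ≤ (⨆ n, U n).topologicalClosure := by
    intro x _
    have hsub : Set.range (TopologicalSpace.denseSeq H) ⊆ (⨆ n, U n : Submodule ℝ H) := by
      rintro _ ⟨n, rfl⟩
      exact Submodule.mem_iSup_of_mem n
        (Submodule.subset_span (Set.mem_image_of_mem _ Set.self_mem_Iic))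
    exact closure_mono hsub (TopologicalSpace.denseRange_denseSeq H x)
  let T (n : ℕ) : H →L[ℝ] U n := c • (U n).orthogonalProjectionOnto
  have hlim (ρ : Measure (H × H)) [IsFiniteMeasure ρ] :
      Tendsto (fun n ↦ ∫ z, Real.exp (-‖T n (z.1 - z.2)‖ ^ 2 / 2) ∂ρ) atTop
        (𝓝 (∫ z, Real.exp (-(c * ‖z.1 - z.2‖) ^ 2 / 2) ∂ρ)) := by
    refine tendsto_integral_of_dominated_convergence (fun _ ↦ 1) (fun n ↦ by fun_prop)
      (integrable_const 1) (fun n ↦ ae_of_all _ fun z ↦ ?_) (ae_of_all _ fun z ↦ ?_)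
    · rw [Real.norm_eq_abs, Real.abs_exp]
      exact exp_neg_sq_div_two_le_one _
    · have h := ((Submodule.starProjection_tendsto_self U hmono (z.1 - z.2) htop).norm.const_mul
        |c|).pow 2
      have h2 := (Real.continuous_exp.tendsto _).comp (h.neg.div_const 2)
      convert! h2 using 2
      · simp [T, norm_smul, ← Submodule.coe_orthogonalProjectionOnto_apply, -map_sub]
      · simp [mul_pow]
  refine ge_of_tendsto' (((hlim _).sub ((hlim _).const_mul 2)).add (hlim _)) fun n ↦ ?_
  exact exp_neg_norm_sq_energy_nonneg_finiteDimensional (T n) μ ν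

lemma gaussianPairing_dirac_le_of_energy_eq_zero (c : ℝ) (μ ν : Measure H) [IsFiniteMeasure μ]
    [IsFiniteMeasure ν]
    (h : gaussianPairing c μ μ - 2 * gaussianPairing c μ ν + gaussianPairing c ν ν = 0) (x : H) :
    gaussianPairing c (Measure.dirac x) ν ≤ gaussianPairing c (Measure.dirac x) μ := by
  have h1 : gaussianPairing c (Measure.dirac x) (Measure.dirac x) = 1 := by
    simp [gaussianPairing_dirac_left]
  have key (s : ℝ≥0) : 0 ≤ 2 * s * (gaussianPairing c (Measure.dirac x) μ -
      gaussianPairing c (Measure.dirac x) ν) + s ^ 2 := by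
    have := gaussianPairing_energy_nonneg c (μ + s • Measure.dirac x) ν
    rw [gaussianPairing_add_smul_left, gaussianPairing_add_smul_left,
      gaussianPairing_comm c μ, gaussianPairing_comm c (Measure.dirac x) (μ + _),
      gaussianPairing_add_smul_left, gaussianPairing_add_smul_left,
      gaussianPairing_comm c μ (Measure.dirac x), h1] at this
    linarith
  by_contra! hlt
  have := key (gaussianPairing c (Measure.dirac x) ν -
    gaussianPairing c (Measure.dirac x) μ).toNNReal
  rw [Real.coe_toNNReal _ (sub_nonneg.2 hlt.le)] at this
  nlinarith [mul_pos (sub_pos.2 hlt) (sub_pos.2 hlt)]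

/-- The Gaussian kernel on a Hilbert space is characteristic. -/
lemma eq_of_gaussianPairing_energy_eq_zero [CompleteSpace H] {c : ℝ} (hc : 0 < c)
    (μ ν : Measure H) [IsProbabilityMeasure μ] [IsProbabilityMeasure ν]
    (h : gaussianPairing c μ μ - 2 * gaussianPairing c μ ν + gaussianPairing c ν ν = 0) :
    μ = ν := by
  have hpot (x : H) : ∫ y, Real.exp (-(c * ‖x - y‖) ^ 2 / 2) ∂μ =
      ∫ y, Real.exp (-(c * ‖x - y‖) ^ 2 / 2) ∂ν := by
    simp_rw [← gaussianPairing_dirac_left]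
    refine le_antisymm (gaussianPairing_dirac_le_of_energy_eq_zero c ν μ ?_ x)
      (gaussianPairing_dirac_le_of_energy_eq_zero c μ ν h x)
    rw [gaussianPairing_comm c ν μ]
    linarith
  let f : H → ℝ := fun y ↦ -(c * ‖y‖) ^ 2 / 2
  have hf (ρ : Measure H) [IsProbabilityMeasure ρ] : Integrable (fun y ↦ Real.exp (f y)) ρ := by
    refine Integrable.of_bound (by fun_prop) 1 (ae_of_all _ fun z ↦ ?_)
    rw [Real.norm_eq_abs, Real.abs_exp]
    exact exp_neg_sq_div_two_le_one _
  have hfactor (u y : H) (t : ℝ) : Real.exp (f y + t * ⟪y, u⟫) =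
      Real.exp ((t * ‖u‖ / c) ^ 2 / 2) *
        Real.exp (-(c * ‖(t / c ^ 2) • u - y‖) ^ 2 / 2) := by
    rw [← Real.exp_add]
    congr 1
    rw [mul_pow, norm_sub_sq_real, norm_smul, real_inner_smul_left, mul_pow, Real.norm_eq_abs,
      sq_abs, real_inner_comm y u]
    simp only [f]
    field_simp
    ring
  have hexp (ρ : Measure H) [IsProbabilityMeasure ρ] (u : H) (t : ℝ) :
      Integrable (fun y ↦ Real.exp (t * ⟪y, u⟫)) (ρ.tilted f) := by
    rw [integrable_tilted_iff (hf ρ)]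
    simp_rw [smul_eq_mul, ← Real.exp_add, hfactor]
    refine Integrable.const_mul (Integrable.of_bound (by fun_prop) 1 (ae_of_all _ fun z ↦ ?_)) _
    rw [Real.norm_eq_abs, Real.abs_exp]
    exact exp_neg_sq_div_two_le_one _
  have hmgf (u : H) : mgf (fun y ↦ ⟪y, u⟫) (μ.tilted f) = mgf (fun y ↦ ⟪y, u⟫) (ν.tilted f) := by
    ext t
    have h0 : ∫ y, Real.exp (f y) ∂μ = ∫ y, Real.exp (f y) ∂ν := by simpa [f] using hpot 0
    simp only [mgf]
    rw [integral_exp_tilted, integral_exp_tilted, h0]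
    simp_rw [Pi.add_apply, hfactor, integral_const_mul, hpot]
  have := isProbabilityMeasure_tilted (hf μ)
  have := isProbabilityMeasure_tilted (hf ν)
  have htilt : μ.tilted f = ν.tilted f := by
    refine Measure.ext_of_charFun (funext fun u ↦ ?_)
    have huniv : integrableExpSet (fun y ↦ ⟪y, u⟫) (μ.tilted f) = Set.univ :=
      Set.eq_univ_of_forall fun t ↦ hexp μ u t
    have := eqOn_complexMGF_of_mgf (hmgf u) (x := Complex.I) (by simp [huniv])
    simpa [complexMGF, charFun_apply, mul_comm] using this
  rw [← tilted_neg_same (hf μ), htilt, tilted_neg_same (hf ν)]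

end GaussianKernel

section NormIntegralRepresentation

lemma one_sub_exp_neg_sq_div_nonneg (a s : ℝ) :
    0 ≤ (1 - Real.exp (-a ^ 2 / 2)) / s ^ 2 :=
  div_nonneg (sub_nonneg.2 (exp_neg_sq_div_two_le_one _)) (sq_nonneg _)

lemma integrable_one_sub_exp_neg_sq_div :
    Integrable fun s : ℝ ↦ (1 - Real.exp (-s ^ 2 / 2)) / s ^ 2 := by
  refine (integrable_inv_one_add_sq.const_mul 2).mono'
    (Measurable.aestronglyMeasurable (by fun_prop)) (ae_of_all _ fun s ↦ ?_)
  rw [Real.norm_of_nonneg (one_sub_exp_neg_sq_div_nonneg _ _), ← div_eq_mul_inv]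
  rcases eq_or_ne s 0 with rfl | hs
  · simp
  have hs2 : 0 < s ^ 2 := by positivity
  rw [div_le_div_iff₀ hs2 (by positivity)]
  have h1 := Real.add_one_le_exp (-s ^ 2 / 2)
  have h2 := Real.exp_pos (-s ^ 2 / 2)
  nlinarith

lemma integral_Ioi_one_sub_exp_neg_sq_div_pos :
    0 < ∫ s in Set.Ioi (0 : ℝ), (1 - Real.exp (-s ^ 2 / 2)) / s ^ 2 := by
  rw [setIntegral_pos_iff_support_of_nonneg_ae
    (ae_of_all _ fun s ↦ one_sub_exp_neg_sq_div_nonneg s s)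
    integrable_one_sub_exp_neg_sq_div.integrableOn, Set.inter_eq_right.2]
  · simp
  · intro s (hs : 0 < s)
    refine (div_pos (sub_pos.2 (Real.exp_lt_one_iff.2 ?_)) (by positivity)).ne'
    have : 0 < s ^ 2 := by positivity
    linarith

lemma one_sub_exp_neg_mul_sq_div_eq {r : ℝ} (hr : r ≠ 0) (s : ℝ) :
    (1 - Real.exp (-(s * r) ^ 2 / 2)) / s ^ 2 =
      r ^ 2 * ((1 - Real.exp (-(s * r) ^ 2 / 2)) / (s * r) ^ 2) := by
  rw [mul_pow s r, ← mul_div_assoc, mul_comm (r ^ 2), mul_div_mul_right _ _ (pow_ne_zero 2 hr)]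

lemma integrableOn_one_sub_exp_neg_mul_sq_div {r : ℝ} (hr : 0 ≤ r) :
    IntegrableOn (fun s : ℝ ↦ (1 - Real.exp (-(s * r) ^ 2 / 2)) / s ^ 2) (Set.Ioi 0) := by
  rcases hr.eq_or_lt with rfl | hr
  · simp
  simp_rw [one_sub_exp_neg_mul_sq_div_eq hr.ne']
  exact ((integrable_one_sub_exp_neg_sq_div.comp_mul_right' hr.ne').const_mul _).integrableOn

lemma integral_Ioi_one_sub_exp_neg_mul_sq_div {r : ℝ} (hr : 0 ≤ r) :
    ∫ s in Set.Ioi (0 : ℝ), (1 - Real.exp (-(s * r) ^ 2 / 2)) / s ^ 2 =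
      r * ∫ s in Set.Ioi (0 : ℝ), (1 - Real.exp (-s ^ 2 / 2)) / s ^ 2 := by
  rcases hr.eq_or_lt with rfl | hr
  · simp
  simp_rw [one_sub_exp_neg_mul_sq_div_eq hr.ne']
  rw [integral_const_mul,
    integral_comp_mul_right_Ioi (fun s ↦ (1 - Real.exp (-s ^ 2 / 2)) / s ^ 2) 0 hr]
  simp only [zero_mul, smul_eq_mul]
  field_simp

variable {H : Type*} [NormedAddCommGroup H] [MeasurableSpace H] [BorelSpace H]
  [SecondCountableTopology H]

lemma integrable_one_sub_exp_neg_mul_norm_sub_sq_div (ρ : Measure (H × H)) [SFinite ρ]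
    (h : Integrable (fun z ↦ ‖z.1 - z.2‖) ρ) :
    Integrable (fun p : (H × H) × ℝ ↦
      (1 - Real.exp (-(p.2 * ‖p.1.1 - p.1.2‖) ^ 2 / 2)) / p.2 ^ 2)
      (ρ.prod (volume.restrict (Set.Ioi 0))) := by
  rw [integrable_prod_iff (Measurable.aestronglyMeasurable (by fun_prop))]
  constructor
  · refine ae_of_all _ fun z ↦ ?_
    have hz := integrableOn_one_sub_exp_neg_mul_sq_div (norm_nonneg (z.1 - z.2))
    exact hz
  · refine (h.mul_const (∫ s in Set.Ioi (0 : ℝ), (1 - Real.exp (-s ^ 2 / 2)) / s ^ 2)).congr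
      (ae_of_all _ fun z ↦ ?_)
    dsimp only
    rw [← integral_Ioi_one_sub_exp_neg_mul_sq_div (norm_nonneg (z.1 - z.2))]
    exact integral_congr_ae (ae_of_all _ fun s ↦
      (Real.norm_of_nonneg (one_sub_exp_neg_sq_div_nonneg _ _)).symm)

lemma integral_one_sub_exp_eq_one_sub_gaussianPairing (s : ℝ) (μ ν : Measure H)
    [IsProbabilityMeasure μ] [IsProbabilityMeasure ν] :
    ∫ z, (1 - Real.exp (-(s * ‖z.1 - z.2‖) ^ 2 / 2)) / s ^ 2 ∂(μ.prod ν) =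
      (1 - gaussianPairing s μ ν) / s ^ 2 := by
  rw [integral_div, integral_sub (integrable_const 1) (integrable_gaussianKernel s _)]
  simp [gaussianPairing]

lemma integrableOn_one_sub_gaussianPairing_div (μ ν : Measure H) [IsProbabilityMeasure μ]
    [IsProbabilityMeasure ν] (h : Integrable (fun z ↦ ‖z.1 - z.2‖) (μ.prod ν)) :
    IntegrableOn (fun s ↦ (1 - gaussianPairing s μ ν) / s ^ 2) (Set.Ioi 0) := by
  simp_rw [← integral_one_sub_exp_eq_one_sub_gaussianPairing]
  exact (integrable_one_sub_exp_neg_mul_norm_sub_sq_div _ h).integral_prod_right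

lemma integral_norm_sub_mul_eq_integral_gaussianPairing (μ ν : Measure H)
    [IsProbabilityMeasure μ] [IsProbabilityMeasure ν]
    (h : Integrable (fun z ↦ ‖z.1 - z.2‖) (μ.prod ν)) :
    (∫ x, ∫ y, ‖x - y‖ ∂ν ∂μ) * ∫ s in Set.Ioi (0 : ℝ), (1 - Real.exp (-s ^ 2 / 2)) / s ^ 2 =
      ∫ s in Set.Ioi 0, (1 - gaussianPairing s μ ν) / s ^ 2 := by
  simp_rw [← integral_one_sub_exp_eq_one_sub_gaussianPairing]
  have hswap := integral_integral_swap
    (f := fun (z : H × H) s ↦ (1 - Real.exp (-(s * ‖z.1 - z.2‖) ^ 2 / 2)) / s ^ 2)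
    (integrable_one_sub_exp_neg_mul_norm_sub_sq_div _ h)
  simp_rw [integral_Ioi_one_sub_exp_neg_mul_sq_div (norm_nonneg _)] at hswap
  rw [← hswap, integral_mul_const, integral_prod _ h]

lemma integrable_norm_sub_prod {μ ν : Measure H} [IsProbabilityMeasure μ]
    [IsProbabilityMeasure ν] (hμ : Integrable (fun x ↦ ‖x‖) μ)
    (hν : Integrable (fun x ↦ ‖x‖) ν) :
    Integrable (fun z ↦ ‖z.1 - z.2‖) (μ.prod ν) :=
  ((hμ.comp_fst ν).add (hν.comp_snd μ)).mono' (by fun_prop)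
    (ae_of_all _ fun z ↦ by simpa using norm_sub_le z.1 z.2)

end NormIntegralRepresentation

theorem separable_hilbert_space_strong_negative_type
    {H : Type*} [NormedAddCommGroup H] [InnerProductSpace ℝ H] [CompleteSpace H]
    [TopologicalSpace.SeparableSpace H] [MeasurableSpace H] [BorelSpace H]
    (μ₁ μ₂ : Measure H) [IsProbabilityMeasure μ₁] [IsProbabilityMeasure μ₂]
    (h₁ : ∀ x₀ : H, Integrable (fun x => ‖x - x₀‖) μ₁)
    (h₂ : ∀ x₀ : H, Integrable (fun x => ‖x - x₀‖) μ₂) :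
    0 ≤ 2 * (∫ x, ∫ y, ‖x - y‖ ∂μ₂ ∂μ₁)
        - (∫ x, ∫ y, ‖x - y‖ ∂μ₁ ∂μ₁) - (∫ x, ∫ y, ‖x - y‖ ∂μ₂ ∂μ₂) ∧
    (2 * (∫ x, ∫ y, ‖x - y‖ ∂μ₂ ∂μ₁)
        - (∫ x, ∫ y, ‖x - y‖ ∂μ₁ ∂μ₁) - (∫ x, ∫ y, ‖x - y‖ ∂μ₂ ∂μ₂) = 0 ↔ μ₁ = μ₂) := by
  have : SecondCountableTopology H := UniformSpace.secondCountable_of_separable H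
  have h₁' : Integrable (fun x => ‖x‖) μ₁ := by simpa using h₁ 0
  have h₂' : Integrable (fun x => ‖x‖) μ₂ := by simpa using h₂ 0
  have h11 := integrable_norm_sub_prod h₁' h₁'
  have h12 := integrable_norm_sub_prod h₁' h₂'
  have h22 := integrable_norm_sub_prod h₂' h₂'
  set C := ∫ s in Set.Ioi (0 : ℝ), (1 - Real.exp (-s ^ 2 / 2)) / s ^ 2 with hC
  have hCpos : 0 < C := integral_Ioi_one_sub_exp_neg_sq_div_pos
  let Q : ℝ → ℝ := fun s ↦ 2 * ((1 - gaussianPairing s μ₁ μ₂) / s ^ 2) -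
    (1 - gaussianPairing s μ₁ μ₁) / s ^ 2 - (1 - gaussianPairing s μ₂ μ₂) / s ^ 2
  have hQ_eq (s : ℝ) : Q s = (gaussianPairing s μ₁ μ₁ - 2 * gaussianPairing s μ₁ μ₂ +
      gaussianPairing s μ₂ μ₂) / s ^ 2 := by
    simp only [Q]
    ring
  have hQ_nonneg (s : ℝ) : 0 ≤ Q s := by
    rw [hQ_eq]
    exact div_nonneg (gaussianPairing_energy_nonneg s μ₁ μ₂) (sq_nonneg s)
  have hi11 := integrableOn_one_sub_gaussianPairing_div μ₁ μ₁ h11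
  have hi12 := (integrableOn_one_sub_gaussianPairing_div μ₁ μ₂ h12).const_mul 2
  have hi22 := integrableOn_one_sub_gaussianPairing_div μ₂ μ₂ h22
  have hQ_int : IntegrableOn Q (Set.Ioi 0) := (hi12.sub hi11).sub hi22
  have hmain : (2 * (∫ x, ∫ y, ‖x - y‖ ∂μ₂ ∂μ₁) - (∫ x, ∫ y, ‖x - y‖ ∂μ₁ ∂μ₁) -
      (∫ x, ∫ y, ‖x - y‖ ∂μ₂ ∂μ₂)) * C = ∫ s in Set.Ioi 0, Q s := by
    rw [sub_mul, sub_mul, mul_assoc, integral_norm_sub_mul_eq_integral_gaussianPairing _ _ h11,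
      integral_norm_sub_mul_eq_integral_gaussianPairing _ _ h12,
      integral_norm_sub_mul_eq_integral_gaussianPairing _ _ h22, ← integral_const_mul,
      ← integral_sub hi12 hi11, ← integral_sub ?_ hi22]
    exact hi12.sub hi11
  refine ⟨nonneg_of_mul_nonneg_left (hmain ▸ integral_nonneg hQ_nonneg) hCpos,
    fun h ↦ ?_, fun h ↦ by subst h; ring⟩
  rw [h, zero_mul, eq_comm, setIntegral_eq_zero_iff_of_nonneg_ae (ae_of_all _ hQ_nonneg) hQ_int]
    at hmain
  have : (ae (volume.restrict (Set.Ioi (0 : ℝ)))).NeBot := by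
    rw [ae_neBot, Ne, Measure.restrict_eq_zero]
    simp
  obtain ⟨s, hs, hspos⟩ := (hmain.and (ae_restrict_mem measurableSet_Ioi)).exists
  refine eq_of_gaussianPairing_energy_eq_zero hspos μ₁ μ₂ ?_
  rw [hQ_eq] at hs
  have hspos : 0 < s := hspos
  exact (div_eq_zero_iff.1 hs).resolve_right (by positivity)
end

section
/- Let (Ω, μ) be a measure space, let 1 ≤ p ≤ 2 be a real number, let f₁, …, fₙ ∈ Lᵖ(μ) (real-valued), and let α₁, …, αₙ be real numbers with Σᵢ αᵢ = 0. Then Σ_{i,j=1}^{n} αᵢ αⱼ ‖fᵢ − fⱼ‖_p ≤ 0, where ‖·‖_p denotes the Lᵖ norm. -/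
open MeasureTheory

/-- A real kernel is of negative type if its quadratic form is nonpositive on the vectors whose
coordinates sum to zero. -/
def IsNegativeType {ι : Type*} [Fintype ι] (ψ : ι → ι → ℝ) : Prop :=
  ∀ α : ι → ℝ, ∑ i, α i = 0 → ∑ i, ∑ j, α i * α j * ψ i j ≤ 0

theorem Matrix.posSemidef_iff_sum_nonneg {ι : Type*} [Fintype ι] {M : Matrix ι ι ℝ} :
    M.PosSemidef ↔ (∀ i j, M i j = M j i) ∧ ∀ x : ι → ℝ, 0 ≤ ∑ i, ∑ j, x i * x j * M i j := by
  have key (x : ι → ℝ) : dotProduct (star x) (M.mulVec x) = ∑ i, ∑ j, x i * x j * M i j := by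
    simp only [dotProduct, Matrix.mulVec, Finset.mul_sum, Pi.star_apply, star_trivial]
    exact Finset.sum_congr rfl fun i _ => Finset.sum_congr rfl fun j _ => by ring
  rw [Matrix.posSemidef_iff_dotProduct_mulVec]
  simp only [key]
  refine and_congr_left fun _ => ⟨fun h i j => ?_, fun h => ?_⟩
  · simpa using (h.apply i j).symm
  · exact Matrix.IsHermitian.ext fun i j => by simpa using h j i

theorem Matrix.PosSemidef.map_pow {ι : Type*} [Fintype ι] {M : Matrix ι ι ℝ}
    (hM : M.PosSemidef) (k : ℕ) : (M.map (· ^ k)).PosSemidef := by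
  induction k with
  | zero =>
    convert Matrix.posSemidef_vecMulVec_self_star (1 : ι → ℝ) using 1
    ext i j
    simp [Matrix.vecMulVec]
  | succ k ih =>
    have hsucc : M.map (· ^ (k + 1)) = (M.map (· ^ k)).hadamard M := by
      ext i j
      simp [pow_succ]
    rw [hsucc]
    exact ih.hadamard hM

theorem Matrix.PosSemidef.map_exp {ι : Type*} [Fintype ι] {M : Matrix ι ι ℝ}
    (hM : M.PosSemidef) : (M.map Real.exp).PosSemidef := by
  rw [Matrix.posSemidef_iff_sum_nonneg]
  refine ⟨fun i j => by simp [(Matrix.posSemidef_iff_sum_nonneg.1 hM).1 i j], fun x => ?_⟩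
  have hexp (r : ℝ) : HasSum (fun k : ℕ => r ^ k / (k.factorial : ℝ)) (Real.exp r) := by
    rw [Real.exp_eq_exp_ℝ]
    exact NormedSpace.expSeries_div_hasSum_exp r
  have hsum : HasSum (fun k : ℕ => ∑ i, ∑ j, x i * x j * (M i j ^ k / (k.factorial : ℝ)))
      (∑ i, ∑ j, x i * x j * M.map Real.exp i j) :=
    hasSum_sum fun i _ => hasSum_sum fun j _ => (hexp (M i j)).mul_left _
  refine hsum.nonneg fun k => ?_
  have hk := (Matrix.posSemidef_iff_sum_nonneg.1 (hM.map_pow k)).2 x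
  simp only [Matrix.map_apply] at hk
  simp only [mul_div_assoc', ← Finset.sum_div]
  positivity

namespace IsNegativeType

variable {ι : Type*} [Fintype ι] {ψ : ι → ι → ℝ}

theorem const_mul (h : IsNegativeType ψ) {s : ℝ} (hs : 0 ≤ s) :
    IsNegativeType fun i j => s * ψ i j := by
  intro α hα
  simp only [mul_left_comm _ s, ← Finset.mul_sum]
  exact mul_nonpos_of_nonneg_of_nonpos hs (h α hα)

theorem integral {Ω : Type*} [MeasurableSpace Ω] {μ : Measure Ω} {φ : ι → ι → Ω → ℝ}
    (hφ : ∀ i j, Integrable (φ i j) μ)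
    (h : ∀ᵐ ω ∂μ, IsNegativeType fun i j => φ i j ω) :
    IsNegativeType fun i j => ∫ ω, φ i j ω ∂μ := by
  intro α hα
  simp only [← integral_const_mul]
  have hi (i j) : Integrable (fun ω => α i * α j * φ i j ω) μ := (hφ i j).const_mul _
  simp_rw [← integral_finsetSum Finset.univ fun j _ => hi _ j]
  rw [← integral_finsetSum Finset.univ fun i _ => integrable_finsetSum _ fun j _ => hi i j]
  exact integral_nonpos_of_ae (h.mono fun ω hω => hω α hα)

theorem posSemidef_gram [DecidableEq ι] (h : IsNegativeType ψ) (hsymm : ∀ i j, ψ i j = ψ j i)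
    (o : ι) : (Matrix.of fun i j => ψ i o + ψ o j - ψ i j - ψ o o).PosSemidef := by
  rw [Matrix.posSemidef_iff_sum_nonneg]
  refine ⟨fun i j => ?_, fun x => ?_⟩
  · simp only [Matrix.of_apply, hsymm i j, hsymm i o, hsymm o j]
    ring
  obtain ⟨S, hS⟩ : ∃ S, ∑ i, x i = S := ⟨_, rfl⟩
  have hx := h (fun i => x i - if i = o then S else 0) (by simp [Finset.sum_sub_distrib, hS])
  have e1 : ∑ i, ∑ j, x i * x j * ψ i o = S * ∑ i, x i * ψ i o := by
    rw [← hS, mul_comm, Finset.sum_mul_sum]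
    exact Finset.sum_congr rfl fun i _ => Finset.sum_congr rfl fun j _ => by ring
  have e2 : ∑ i, ∑ j, x i * x j * ψ o j = S * ∑ j, x j * ψ o j := by
    rw [← hS, Finset.sum_mul_sum]
    exact Finset.sum_congr rfl fun i _ => Finset.sum_congr rfl fun j _ => by ring
  have e3 : ∑ i, ∑ j, x i * x j * ψ o o = S * S * ψ o o := by
    simp only [← Finset.sum_mul, ← Finset.sum_mul_sum, hS]
  have e4 : ∑ i, x i * S * ψ i o = S * ∑ i, x i * ψ i o := by
    rw [Finset.mul_sum]
    exact Finset.sum_congr rfl fun i _ => by ring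
  have e5 : ∑ j, S * x j * ψ o j = S * ∑ j, x j * ψ o j := by
    simp only [Finset.mul_sum, mul_assoc]
  simp only [sub_mul, mul_sub, Finset.sum_sub_distrib, ite_mul, mul_ite, zero_mul, mul_zero,
    Finset.sum_ite_eq', Finset.sum_ite_irrel, Finset.sum_const_zero, Finset.mem_univ, if_true,
    e4, e5] at hx
  simp only [Matrix.of_apply, mul_sub, mul_add, Finset.sum_sub_distrib, Finset.sum_add_distrib,
    e1, e2, e3]
  linarith

/-- **Schoenberg's theorem**: the exponential of minus a symmetric kernel of negative type is
positive semidefinite. -/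
theorem posSemidef_exp_neg (h : IsNegativeType ψ) (hsymm : ∀ i j, ψ i j = ψ j i) :
    (Matrix.of fun i j => Real.exp (-ψ i j)).PosSemidef := by
  classical
  rcases isEmpty_or_nonempty ι with hι | ⟨⟨o⟩⟩
  · rw [Matrix.posSemidef_iff_sum_nonneg]
    simp
  have hK := (h.posSemidef_gram hsymm o).map_exp
  have ha := Matrix.posSemidef_vecMulVec_self_star fun i => Real.exp (ψ o o / 2 - ψ i o)
  refine (congrArg Matrix.PosSemidef ?_).mpr (hK.hadamard ha)
  ext i j
  simp only [Matrix.of_apply, Matrix.hadamard_apply, Matrix.map_apply, Matrix.vecMulVec_apply,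
    star_trivial, ← Real.exp_add, hsymm o j]
  ring_nf

theorem sum_mul_inv_add_nonneg (h : IsNegativeType ψ) (hsymm : ∀ i j, ψ i j = ψ j i)
    (hψ : ∀ i j, 0 ≤ ψ i j) {t : ℝ} (ht : 0 < t) (x : ι → ℝ) :
    0 ≤ ∑ i, ∑ j, x i * x j * (t + ψ i j)⁻¹ := by
  have hpos (i j) : 0 < t + ψ i j := add_pos_of_pos_of_nonneg ht (hψ i j)
  have hint (i j) : Integrable (fun s => x i * x j * Real.exp (-(t + ψ i j) * s))
      (volume.restrict (Set.Ioi 0)) := (exp_neg_integrableOn_Ioi 0 (hpos i j)).const_mul _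
  have hlap (i j) : (t + ψ i j)⁻¹ = ∫ s in Set.Ioi (0 : ℝ), Real.exp (-(t + ψ i j) * s) := by
    rw [integral_exp_mul_Ioi (neg_lt_zero.2 (hpos i j))]
    simp [neg_div_neg_eq, -neg_add_rev]
  simp only [hlap, ← integral_const_mul]
  simp_rw [← integral_finsetSum Finset.univ fun j _ => hint _ j]
  rw [← integral_finsetSum Finset.univ fun i _ => integrable_finsetSum _ fun j _ => hint i j]
  refine setIntegral_nonneg measurableSet_Ioi fun s hs => ?_
  have hE := (Matrix.posSemidef_iff_sum_nonneg.1 <| (h.const_mul (le_of_lt hs)).posSemidef_exp_neg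
    fun i j => by rw [hsymm]).2 x
  simp only [Matrix.of_apply] at hE
  have hfac : ∑ i, ∑ j, x i * x j * Real.exp (-(t + ψ i j) * s)
      = Real.exp (-t * s) * ∑ i, ∑ j, x i * x j * Real.exp (-(s * ψ i j)) := by
    simp only [Finset.mul_sum]
    refine Finset.sum_congr rfl fun i _ => Finset.sum_congr rfl fun j _ => ?_
    rw [mul_left_comm, ← Real.exp_add]
    ring_nf
  rw [hfac]
  positivity

/-- Powers with exponent in `(0, 1]` preserve symmetric nonnegative kernels of negative type. -/
theorem rpow (h : IsNegativeType ψ) (hsymm : ∀ i j, ψ i j = ψ j i) (hψ : ∀ i j, 0 ≤ ψ i j)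
    {β : ℝ} (hβ0 : 0 < β) (hβ1 : β ≤ 1) : IsNegativeType fun i j => ψ i j ^ β := by
  rcases hβ1.eq_or_lt with rfl | hβ1
  · simpa using h
  have hβ : β ∈ Set.Ioo (0 : ℝ) 1 := ⟨hβ0, hβ1⟩
  simp only [fun i j => Real.rpow_eq_const_mul_integral hβ (hψ i j)]
  refine const_mul (integral (fun i j => Real.integrableOn_rpowIntegrand₀₁_Ioi hβ (hψ i j)) ?_)
    (inv_nonneg.2 (Real.integral_rpowIntegrand₀₁_one_pos hβ).le)
  filter_upwards [ae_restrict_mem measurableSet_Ioi] with t ht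
  refine const_mul (fun α hα => ?_) (Real.rpow_nonneg (le_of_lt ht) β)
  have hconst : ∑ i, ∑ j, α i * α j * t⁻¹ = 0 := by
    simp only [← Finset.sum_mul, ← Finset.sum_mul_sum, hα, zero_mul]
  simp only [mul_sub, Finset.sum_sub_distrib, hconst]
  linarith [h.sum_mul_inv_add_nonneg hsymm hψ ht α]

theorem sq_sub (a : ι → ℝ) : IsNegativeType fun i j => (a i - a j) ^ 2 := by
  intro α hα
  have expand : ∑ i, ∑ j, α i * α j * (a i - a j) ^ 2
      = 2 * (∑ i, α i) * (∑ i, α i * a i ^ 2) - 2 * (∑ i, α i * a i) ^ 2 := by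
    have e (i j) : α i * α j * (a i - a j) ^ 2
        = α i * a i ^ 2 * α j + α i * (α j * a j ^ 2) - 2 * (α i * a i * (α j * a j)) := by ring
    simp only [e, Finset.sum_sub_distrib, Finset.sum_add_distrib, ← Finset.mul_sum,
      ← Finset.sum_mul]
    ring
  rw [expand, hα]
  nlinarith [sq_nonneg (∑ i, α i * a i)]

theorem abs_sub_rpow (a : ι → ℝ) {p : ℝ} (hp0 : 0 < p) (hp2 : p ≤ 2) :
    IsNegativeType fun i j => |a i - a j| ^ p := by
  have h := (sq_sub a).rpow (fun i j => by ring) (fun i j => sq_nonneg _)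
    (half_pos hp0) (by linarith)
  convert h using 3 with i j
  rw [← sq_abs, ← Real.rpow_natCast_mul (abs_nonneg _)]
  congr 1
  push_cast
  ring

end IsNegativeType

theorem Lp_norm_eq_integral_rpow {Ω : Type*} [MeasurableSpace Ω] {μ : Measure Ω}
    {p : ℝ} (hp : 0 < p) (g : Lp ℝ (ENNReal.ofReal p) μ) :
    ‖g‖ = (∫ ω, |g ω| ^ p ∂μ) ^ p⁻¹ := by
  rw [Lp.norm_def, toReal_eLpNorm (Lp.aestronglyMeasurable g),
    lpNorm_eq_integral_norm_rpow_toReal (by simpa using hp) ENNReal.ofReal_ne_top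
      (Lp.aestronglyMeasurable g), ENNReal.toReal_ofReal hp.le]
  rfl

theorem Lp_negative_type
    {Ω : Type*} [MeasurableSpace Ω] (μ : Measure Ω)
    (p : ℝ) (hp1 : 1 ≤ p) (hp2 : p ≤ 2)
    (n : ℕ) (f : Fin n → Lp ℝ (ENNReal.ofReal p) μ)
    (α : Fin n → ℝ) (hα : ∑ i, α i = 0) :
    ∑ i : Fin n, ∑ j : Fin n, α i * α j * ‖f i - f j‖ ≤ 0 := by
  have hp0 : 0 < p := by linarith
  have hint (i j) : Integrable (fun ω => |f i ω - f j ω| ^ p) μ := by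
    have hmem := ((Lp.memLp (f i)).sub (Lp.memLp (f j))).integrable_norm_rpow
      (by simpa using hp0) ENNReal.ofReal_ne_top
    simpa [ENNReal.toReal_ofReal hp0.le] using hmem
  have hnorm (i j) : ‖f i - f j‖ = (∫ ω, |f i ω - f j ω| ^ p ∂μ) ^ p⁻¹ := by
    rw [Lp_norm_eq_integral_rpow hp0]
    congr 1
    refine integral_congr_ae ?_
    filter_upwards [Lp.coeFn_sub (f i) (f j)] with ω hω
    rw [hω, Pi.sub_apply]
  have hneg := IsNegativeType.integral hint
    (.of_forall fun ω => IsNegativeType.abs_sub_rpow (fun i => f i ω) hp0 hp2)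
  simp only [hnorm]
  exact hneg.rpow (fun i j => by simp only [abs_sub_comm])
    (fun i j => integral_nonneg fun ω => by positivity) (inv_pos.2 hp0)
    (inv_le_one_of_one_le₀ hp1) α hα
end

section
/- Let (X, d) be a metric space and μ a Borel probability measure on X with finite first moment whose support contains at least two distinct points. Define a_μ(x) = ∫ d(x, y) dμ(y) and D(μ) = ∫ a_μ(x) dμ(x). Then a_μ(x) > D(μ)/2 for every x ∈ X; equivalently, the doubly centred distance satisfies d_μ(x, x) = D(μ) − 2 a_μ(x) < 0 for every x ∈ X. -/
open MeasureTheory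

/-- A nonnegative continuous integrable function that is positive at a point of the support
has positive integral. -/
theorem integral_pos_of_continuous_of_pos_at
    {X : Type*} [PseudoMetricSpace X] [MeasurableSpace X] {μ : Measure X}
    {f : X → ℝ} (hf : Continuous f) (hf0 : ∀ x, 0 ≤ f x) (hfi : Integrable f μ)
    {p : X} (hp : ∀ ε > 0, 0 < μ (Metric.ball p ε)) (hfp : 0 < f p) :
    0 < ∫ x, f x ∂μ := by
  rw [integral_pos_iff_support_of_nonneg hf0 hfi]
  obtain ⟨ε, hε, hball⟩ := Metric.isOpen_iff.1 hf.isOpen_support p hfp.ne'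
  exact (hp ε hε).trans_le (measure_mono hball)

theorem integral_dist_le_dist_add_integral_dist
    {X : Type*} [PseudoMetricSpace X] [MeasurableSpace X]
    {μ : Measure X} [IsProbabilityMeasure μ]
    (hfm : ∀ x : X, Integrable (fun y => dist x y) μ) (x y : X) :
    ∫ z, dist y z ∂μ ≤ dist x y + ∫ z, dist x z ∂μ := by
  calc ∫ z, dist y z ∂μ ≤ ∫ z, (dist x y + dist x z) ∂μ :=
        integral_mono (hfm y) ((integrable_const _).add (hfm x))
          fun z => dist_triangle_left y z x
    _ = dist x y + ∫ z, dist x z ∂μ := by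
        rw [integral_add (integrable_const _) (hfm x)]; simp

theorem continuous_integral_dist
    {X : Type*} [PseudoMetricSpace X] [MeasurableSpace X]
    {μ : Measure X} [IsProbabilityMeasure μ]
    (hfm : ∀ x : X, Integrable (fun y => dist x y) μ) :
    Continuous fun x => ∫ y, dist x y ∂μ :=
  (LipschitzWith.of_le_add fun x y => by
    have := integral_dist_le_dist_add_integral_dist hfm y x
    rw [dist_comm x y]
    linarith).continuous

theorem integrable_integral_dist
    {X : Type*} [PseudoMetricSpace X] [MeasurableSpace X] [OpensMeasurableSpace X]
    {μ : Measure X} [IsProbabilityMeasure μ]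
    (hfm : ∀ x : X, Integrable (fun y => dist x y) μ) :
    Integrable (fun x => ∫ y, dist x y ∂μ) μ := by
  obtain ⟨x⟩ : Nonempty X := nonempty_of_isProbabilityMeasure μ
  refine ((hfm x).add (integrable_const (∫ z, dist x z ∂μ))).mono'
    (continuous_integral_dist hfm).measurable.aestronglyMeasurable (.of_forall fun y => ?_)
  rw [Real.norm_of_nonneg (integral_nonneg fun _ => dist_nonneg)]
  exact integral_dist_le_dist_add_integral_dist hfm x y

theorem expected_distance_gt_half_total
    {X : Type*} [MetricSpace X] [MeasurableSpace X] [BorelSpace X]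
    (μ : Measure X) [IsProbabilityMeasure μ]
    (hfm : ∀ x : X, Integrable (fun y => dist x y) μ)
    (hsupp : ∃ x₁ x₂ : X, x₁ ≠ x₂ ∧
      (∀ ε > 0, 0 < μ (Metric.ball x₁ ε)) ∧ (∀ ε > 0, 0 < μ (Metric.ball x₂ ε))) :
    let aμ : X → ℝ := fun x => ∫ y, dist x y ∂μ
    let D : ℝ := ∫ x, aμ x ∂μ
    ∀ x : X, aμ x > D / 2 ∧ D - 2 * aμ x < 0 := by
  intro aμ D x
  suffices h : D < 2 * aμ x from ⟨by linarith, by linarith⟩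
  obtain ⟨p, hxp, hp⟩ : ∃ p, x ≠ p ∧ ∀ ε > 0, 0 < μ (Metric.ball p ε) := by
    obtain ⟨x₁, x₂, hne, h₁, h₂⟩ := hsupp
    by_cases h : x = x₁
    · exact ⟨x₂, h ▸ hne, h₂⟩
    · exact ⟨x₁, h, h₁⟩
  have hai : Integrable aμ μ := integrable_integral_dist hfm
  have hac : Continuous aμ := continuous_integral_dist hfm
  have hap : aμ p < dist x p + aμ x := by
    have hi : Integrable (fun z => dist x p + dist x z) μ := (integrable_const _).add (hfm x)
    have hpos : 0 < ∫ z, (dist x p + dist x z - dist p z) ∂μ := by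
      refine integral_pos_of_continuous_of_pos_at (by fun_prop)
        (fun z => sub_nonneg.2 (dist_triangle_left p z x)) (hi.sub (hfm p)) hp ?_
      have := dist_pos.2 hxp
      simpa using this
    rw [integral_sub hi (hfm p), integral_add (integrable_const _) (hfm x)] at hpos
    simp only [integral_const, probReal_univ, one_smul] at hpos
    exact sub_pos.1 hpos
  have hi : Integrable (fun y => dist x y + aμ x) μ := (hfm x).add (integrable_const _)
  have hpos : 0 < ∫ y, (dist x y + aμ x - aμ y) ∂μ :=
    integral_pos_of_continuous_of_pos_at (by fun_prop)
      (fun y => sub_nonneg.2 (integral_dist_le_dist_add_integral_dist hfm x y))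
      (hi.sub hai) hp (sub_pos.2 hap)
  rw [integral_sub hi hai, integral_add (hfm x) (integrable_const _)] at hpos
  simp only [integral_const, probReal_univ, one_smul] at hpos
  change 0 < aμ x + aμ x - D at hpos
  linarith
end

section
/- Let (X, d_X) and (Y, d_Y) be separable metric spaces, each of strong negative type, meaning: for all Borel probability measures ρ₁, ρ₂ on the space with finite first moment, 2∫∫ d dρ₁ dρ₂ − ∫∫ d dρ₁ dρ₁ − ∫∫ d dρ₂ dρ₂ ≥ 0, with equality if and only if ρ₁ = ρ₂. Let θ be a Borel probability measure on X × Y whose marginals μ (on X) and ν (on Y) have finite first moment, and with d_X, d_Y suitably integrable. If the distance covariance dcov(θ) = ∫∫ d_μ(x, x') d_ν(y, y') dθ((x,y)) dθ((x',y')) equals 0, then θ = μ ⊗ ν, i.e. θ is the product of its marginals. -/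
open MeasureTheory

section FeatureMap

/-- A positive semidefinite real kernel is the Gram matrix of a map into a Hilbert space. -/
theorem Matrix.PosSemidef.exists_feature_map.{u} {Z : Type u} {K : Matrix Z Z ℝ}
    (hK : K.PosSemidef) :
    ∃ (H : Type u) (_ : NormedAddCommGroup H) (_ : InnerProductSpace ℝ H) (_ : CompleteSpace H)
      (Φ : Z → H), ∀ z w, inner ℝ (Φ z) (Φ w) = K z w := by
  let L : Matrix Z Z (ℝ →L[ℝ] ℝ) := Matrix.of fun z w => K z w • ContinuousLinearMap.id ℝ ℝ
  have hsymm : ∀ z w, K w z = K z w := fun z w => hK.isHermitian.apply z w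
  have hL : L.PosSemidef := by
    have htfae := (RKHS.posSemidef_tfae (K := L)).out 0 2
    rw [htfae]
    refine ⟨?_, fun v => ?_⟩
    · ext z w
      simp [L, Matrix.conjTranspose_apply, ContinuousLinearMap.star_eq_adjoint,
        ContinuousLinearMap.adjoint_id, hsymm]
    · have := hK.2 v
      simp only [star_trivial] at this
      rw [Finsupp.sum_comm]
      simpa [L, mul_comm, mul_left_comm, mul_assoc] using this
  have : Fact L.PosSemidef := ⟨hL⟩
  refine ⟨RKHS.OfKernel L, inferInstance, inferInstance, inferInstance,
    fun z => RKHS.kerFun (RKHS.OfKernel L) z 1, fun z w => ?_⟩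
  rw [← RKHS.kernel_inner, RKHS.OfKernel.kernel_ofKernel]
  simp [L, hsymm]

/-- If a continuous positive semidefinite kernel has zero energy with respect to a measure, then
its potential vanishes. -/
theorem Matrix.PosSemidef.integral_eq_zero_of_energy_eq_zero {Z : Type*} [TopologicalSpace Z]
    [SecondCountableTopology Z] [MeasurableSpace Z] [OpensMeasurableSpace Z]
    {K : Matrix Z Z ℝ} (hK : K.PosSemidef) (hcont : Continuous fun p : Z × Z => K p.1 p.2)
    {θ : Measure Z} (hint : Integrable (fun z => √(K z z)) θ)
    (henergy : ∫ z, ∫ w, K z w ∂θ ∂θ = 0) (w : Z) : ∫ z, K z w ∂θ = 0 := by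
  obtain ⟨H, _, _, _, Φ, hΦ⟩ := hK.exists_feature_map
  have hΦc : Continuous Φ := by
    rw [continuous_iff_continuousAt]
    intro z
    rw [ContinuousAt, tendsto_iff_norm_sub_tendsto_zero]
    have hnorm : ∀ w, ‖Φ w - Φ z‖ = √(K w w - 2 * K w z + K z z) := fun w => by
      rw [← hΦ, ← hΦ, ← hΦ, real_inner_self_eq_norm_sq, real_inner_self_eq_norm_sq,
        ← norm_sub_sq_real, Real.sqrt_sq (norm_nonneg _)]
    have hdiag : Continuous fun w => K w w := hcont.comp (continuous_id.prodMk continuous_id)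
    have hsec : Continuous fun w => K w z := hcont.comp (continuous_id.prodMk continuous_const)
    have : Continuous fun w => √(K w w - 2 * K w z + K z z) := by fun_prop
    simp_rw [hnorm]
    convert this.tendsto z using 2
    ring_nf
    simp
  have hΦi : Integrable Φ θ := by
    refine hint.mono' hΦc.aestronglyMeasurable (Filter.Eventually.of_forall fun z => ?_)
    rw [← hΦ, real_inner_self_eq_norm_sq, Real.sqrt_sq (norm_nonneg _)]
  have hpot : ∀ w, ∫ z, K z w ∂θ = inner ℝ (∫ z, Φ z ∂θ) (Φ w) := fun w => by
    rw [real_inner_comm, ← integral_inner hΦi]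
    exact integral_congr_ae (Filter.Eventually.of_forall fun z =>
      (hΦ z w).symm.trans (real_inner_comm _ _))
  have hzero : ∫ z, Φ z ∂θ = 0 := by
    rw [← inner_self_eq_zero (𝕜 := ℝ), ← integral_inner hΦi, ← henergy]
    refine integral_congr_ae (Filter.Eventually.of_forall fun z => ?_)
    dsimp only
    rw [real_inner_comm, ← integral_inner hΦi]
    exact integral_congr_ae (Filter.Eventually.of_forall fun w => hΦ z w)
  rw [hpot, hzero, inner_zero_left]

end FeatureMap

/-- A measure on a metric space has finite first moment if all distance functions are
integrable. -/
def HasFiniteFirstMoment {X : Type*} [MetricSpace X] [MeasurableSpace X] (ρ : Measure X) : Prop :=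
  ∀ x : X, Integrable (fun y => dist x y) ρ

/-- The energy `∫∫ dist x y ∂ρ₂ ∂ρ₁` of a pair of measures on a metric space. -/
noncomputable def distEnergy {X : Type*} [MetricSpace X] [MeasurableSpace X] (ρ₁ ρ₂ : Measure X) :
    ℝ :=
  ∫ x, ∫ y, dist x y ∂ρ₂ ∂ρ₁

/-- A metric space has strong negative type if the energy distance of any two probability measures
with finite first moment is nonnegative, and vanishes only if the two measures agree. -/
def HasStrongNegativeType (X : Type*) [MetricSpace X] [MeasurableSpace X] : Prop :=
  ∀ ρ₁ ρ₂ : Measure X, IsProbabilityMeasure ρ₁ → IsProbabilityMeasure ρ₂ →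
    HasFiniteFirstMoment ρ₁ → HasFiniteFirstMoment ρ₂ →
    0 ≤ 2 * distEnergy ρ₁ ρ₂ - distEnergy ρ₁ ρ₁ - distEnergy ρ₂ ρ₂ ∧
      (2 * distEnergy ρ₁ ρ₂ - distEnergy ρ₁ ρ₁ - distEnergy ρ₂ ρ₂ = 0 ↔ ρ₁ = ρ₂)

/-- The expected distance `∫ dist x y ∂μ` from a point to a random point. -/
noncomputable def expectedDist {X : Type*} [MetricSpace X] [MeasurableSpace X] (μ : Measure X)
    (x : X) : ℝ :=
  ∫ y, dist x y ∂μ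

/-- The doubly centred distance function of a measure on a metric space. -/
noncomputable def centeredDist {X : Type*} [MetricSpace X] [MeasurableSpace X] (μ : Measure X)
    (x y : X) : ℝ :=
  dist x y - expectedDist μ x - expectedDist μ y + distEnergy μ μ

section Moments

variable {X : Type*} [MetricSpace X] [MeasurableSpace X]

theorem HasFiniteFirstMoment.abs_expectedDist_sub_le {μ : Measure X} [IsProbabilityMeasure μ]
    (hμ : HasFiniteFirstMoment μ) (x y : X) :
    |expectedDist μ x - expectedDist μ y| ≤ dist x y := by
  rw [expectedDist, expectedDist, ← integral_sub (hμ x) (hμ y)]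
  have := norm_integral_le_of_norm_le_const (μ := μ) (f := fun z => dist x z - dist y z)
    (C := dist x y) (Filter.Eventually.of_forall fun z => by
      simpa using abs_dist_sub_le x y z)
  simpa using this

theorem HasFiniteFirstMoment.continuous_expectedDist {μ : Measure X} [IsProbabilityMeasure μ]
    (hμ : HasFiniteFirstMoment μ) : Continuous (expectedDist μ) := by
  refine LipschitzWith.continuous (K := 1) (LipschitzWith.of_dist_le_mul fun x y => ?_)
  simpa [Real.dist_eq] using hμ.abs_expectedDist_sub_le x y

theorem expectedDist_nonneg (μ : Measure X) (x : X) : 0 ≤ expectedDist μ x :=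
  integral_nonneg fun _ => dist_nonneg

/-- The centred distance function is bounded in its first argument. -/
theorem HasFiniteFirstMoment.abs_centeredDist_le {μ : Measure X} [IsProbabilityMeasure μ]
    (hμ : HasFiniteFirstMoment μ) (x y : X) :
    |centeredDist μ x y| ≤ 2 * expectedDist μ y + |distEnergy μ μ| := by
  have h₁ : |dist x y - expectedDist μ x| ≤ expectedDist μ y := by
    have hconst : dist x y = ∫ _, dist x y ∂μ := by simp
    rw [expectedDist, hconst, ← integral_sub (integrable_const _) (hμ x), ← Real.norm_eq_abs]
    refine norm_integral_le_of_norm_le (hμ y) (Filter.Eventually.of_forall fun z => ?_)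
    rw [Real.norm_eq_abs, dist_comm x y, dist_comm x z, dist_comm y z]
    have := abs_dist_sub_le y z x
    rwa [dist_comm y z] at this
  have h₂ := expectedDist_nonneg μ y
  rw [centeredDist]
  rw [abs_le] at h₁ ⊢
  have h₃ := abs_le.mp (le_refl |distEnergy μ μ|)
  constructor <;> linarith

theorem HasFiniteFirstMoment.integrable_expectedDist [OpensMeasurableSpace X] {μ ρ : Measure X}
    [IsProbabilityMeasure μ] [IsFiniteMeasure ρ] (hμ : HasFiniteFirstMoment μ)
    (hρ : HasFiniteFirstMoment ρ) : Integrable (expectedDist μ) ρ := by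
  rcases isEmpty_or_nonempty X with h | ⟨⟨o⟩⟩
  · rw [Measure.eq_zero_of_isEmpty ρ]
    exact integrable_zero_measure
  refine ((hρ o).add (integrable_const (expectedDist μ o))).mono'
    hμ.continuous_expectedDist.measurable.aestronglyMeasurable
    (Filter.Eventually.of_forall fun x => ?_)
  rw [Real.norm_eq_abs, abs_of_nonneg (expectedDist_nonneg μ x)]
  have := le_of_abs_le (hμ.abs_expectedDist_sub_le x o)
  rw [dist_comm] at this
  simp only [Pi.add_apply]
  linarith

theorem hasFiniteFirstMoment_dirac [OpensMeasurableSpace X] (x : X) :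
    HasFiniteFirstMoment (Measure.dirac x) := fun y =>
  (integrable_dirac' (by
    exact (continuous_const.dist continuous_id).measurable.stronglyMeasurable) (by simp))

theorem expectedDist_dirac [OpensMeasurableSpace X] (x y : X) :
    expectedDist (Measure.dirac y) x = dist x y :=
  integral_dirac' _ _ (continuous_const.dist continuous_id).measurable.stronglyMeasurable

theorem distEnergy_eq_integral_expectedDist (ρ₁ ρ₂ : Measure X) :
    distEnergy ρ₁ ρ₂ = ∫ x, expectedDist ρ₂ x ∂ρ₁ := rfl

theorem HasFiniteFirstMoment.continuous_centeredDist {μ : Measure X} [IsProbabilityMeasure μ]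
    (hμ : HasFiniteFirstMoment μ) : Continuous fun p : X × X => centeredDist μ p.1 p.2 := by
  have := hμ.continuous_expectedDist
  unfold centeredDist
  fun_prop

theorem HasFiniteFirstMoment.integral_centeredDist [OpensMeasurableSpace X] {μ : Measure X}
    [IsProbabilityMeasure μ] (hμ : HasFiniteFirstMoment μ) (y : X) :
    ∫ x, centeredDist μ x y ∂μ = 0 := by
  have hd : Integrable (fun x => dist x y) μ := by simpa only [dist_comm] using hμ y
  have ha := hμ.integrable_expectedDist hμ
  have hda : Integrable (fun x => dist x y - expectedDist μ x) μ := hd.sub ha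
  have hdac : Integrable (fun x => dist x y - expectedDist μ x - expectedDist μ y) μ :=
    hda.sub (integrable_const _)
  have hy : ∫ x, dist x y ∂μ = expectedDist μ y := by simp_rw [dist_comm _ y, expectedDist]
  simp only [centeredDist]
  rw [integral_add hdac (integrable_const _),
    integral_sub hda (integrable_const _), integral_sub hd ha, hy,
    ← distEnergy_eq_integral_expectedDist]
  simp

/-- Swapping the two measures does not change the energy. -/
theorem HasFiniteFirstMoment.distEnergy_comm [SecondCountableTopology X] [OpensMeasurableSpace X]
    {ρ μ : Measure X} [IsProbabilityMeasure ρ] [IsProbabilityMeasure μ]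
    (hρ : HasFiniteFirstMoment ρ) (hμ : HasFiniteFirstMoment μ) :
    distEnergy ρ μ = distEnergy μ ρ := by
  have hint : Integrable (Function.uncurry fun x y : X => dist x y) (ρ.prod μ) := by
    have hc : Continuous (Function.uncurry fun x y : X => dist x y) := continuous_dist
    refine (integrable_prod_iff hc.measurable.aestronglyMeasurable).mpr
      ⟨Filter.Eventually.of_forall hμ, ?_⟩
    have hnorm : ∀ x y : X, ‖dist x y‖ = dist x y := fun x y => Real.norm_of_nonneg dist_nonneg
    simp_rw [Function.uncurry, hnorm]
    exact hμ.integrable_expectedDist hρ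
  rw [distEnergy, integral_integral_swap hint]
  simp_rw [dist_comm, distEnergy]

end Moments

section Mixture

variable {Ω ι : Type*} [MeasurableSpace Ω] [Fintype ι]

/-- The linear combination of finitely many measures with nonnegative real weights. -/
noncomputable def mixtureMeasure (p : ι → ℝ) (m : ι → Measure Ω) : Measure Ω :=
  ∑ i, ENNReal.ofReal (p i) • m i

theorem integrable_mixtureMeasure {p : ι → ℝ} {m : ι → Measure Ω} {f : Ω → ℝ}
    (hf : ∀ i, Integrable f (m i)) : Integrable f (mixtureMeasure p m) :=
  integrable_finsetSum_measure.2 fun i _ => (hf i).smul_measure ENNReal.ofReal_ne_top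

theorem integral_mixtureMeasure {p : ι → ℝ} (hp : ∀ i, 0 ≤ p i) {m : ι → Measure Ω} {f : Ω → ℝ}
    (hf : ∀ i, Integrable f (m i)) :
    ∫ x, f x ∂mixtureMeasure p m = ∑ i, p i * ∫ x, f x ∂m i := by
  rw [mixtureMeasure,
    integral_finsetSum_measure fun i _ => (hf i).smul_measure ENNReal.ofReal_ne_top]
  simp [integral_smul_measure, ENNReal.toReal_ofReal, hp]

theorem isProbabilityMeasure_mixtureMeasure {p : ι → ℝ} (hp : ∀ i, 0 ≤ p i) (hsum : ∑ i, p i = 1)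
    (m : ι → Measure Ω) [∀ i, IsProbabilityMeasure (m i)] :
    IsProbabilityMeasure (mixtureMeasure p m) := by
  constructor
  simp [mixtureMeasure, ← ENNReal.ofReal_sum_of_nonneg fun i _ => hp i, hsum]

end Mixture

section NegativeType

variable {X : Type*} [MetricSpace X] [MeasurableSpace X] [OpensMeasurableSpace X]

theorem distEnergy_mixtureMeasure {ι : Type*} [Fintype ι] {m : ι → Measure X}
    [∀ i, IsProbabilityMeasure (m i)] (hm : ∀ i, HasFiniteFirstMoment (m i)) {p q : ι → ℝ}
    (hp : ∀ i, 0 ≤ p i) (hq : ∀ i, 0 ≤ q i) :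
    distEnergy (mixtureMeasure p m) (mixtureMeasure q m) =
      ∑ i, ∑ j, p i * q j * distEnergy (m i) (m j) := by
  have h₁ : expectedDist (mixtureMeasure q m) = fun x => ∑ j, q j * expectedDist (m j) x :=
    funext fun x => integral_mixtureMeasure hq fun j => hm j x
  have h₂ : ∀ i j, Integrable (fun x => q j * expectedDist (m j) x) (m i) := fun i j =>
    ((hm j).integrable_expectedDist (hm i)).const_mul _
  rw [distEnergy_eq_integral_expectedDist, h₁,
    integral_mixtureMeasure hp fun i => integrable_finsetSum _ fun j _ => h₂ i j]
  refine Finset.sum_congr rfl fun i _ => ?_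
  rw [integral_finsetSum _ fun j _ => h₂ i j, Finset.mul_sum]
  refine Finset.sum_congr rfl fun j _ => ?_
  rw [integral_const_mul, distEnergy_eq_integral_expectedDist, mul_assoc]

/-- In a space of strong negative type the energy form is negative semidefinite on combinations of
probability measures with total weight zero. -/
theorem HasStrongNegativeType.sum_mul_distEnergy_nonpos (hX : HasStrongNegativeType X)
    {ι : Type*} [Fintype ι] {m : ι → Measure X} [∀ i, IsProbabilityMeasure (m i)]
    (hm : ∀ i, HasFiniteFirstMoment (m i)) {c : ι → ℝ} (hc : ∑ i, c i = 0) :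
    ∑ i, ∑ j, c i * c j * distEnergy (m i) (m j) ≤ 0 := by
  have hsplit : ∀ i, c i = (c i)⁺ - (c i)⁻ := fun i => (posPart_sub_negPart _).symm
  have hsum : ∑ i, (c i)⁻ = ∑ i, (c i)⁺ := by
    have : ∑ i, c i = ∑ i, ((c i)⁺ - (c i)⁻) := Finset.sum_congr rfl fun i _ => hsplit i
    rw [hc, Finset.sum_sub_distrib] at this
    linarith
  set s := ∑ i, (c i)⁺ with hs
  rcases (Finset.sum_nonneg fun i _ => posPart_nonneg (c i) : 0 ≤ s).eq_or_lt with h0 | hpos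
  · have hp : ∀ i, (c i)⁺ = 0 := fun i =>
      (Finset.sum_eq_zero_iff_of_nonneg fun i _ => posPart_nonneg (c i)).mp h0.symm i
        (Finset.mem_univ i)
    have hn : ∀ i, (c i)⁻ = 0 := fun i =>
      (Finset.sum_eq_zero_iff_of_nonneg fun i _ => negPart_nonneg (c i)).mp
        (hsum.trans h0.symm) i (Finset.mem_univ i)
    have : ∀ i, c i = 0 := fun i => by rw [hsplit, hp, hn, sub_zero]
    simp [this]
  let p : ι → ℝ := fun i => (c i)⁺ / s
  let q : ι → ℝ := fun i => (c i)⁻ / s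
  have hp : ∀ i, 0 ≤ p i := fun i => div_nonneg (posPart_nonneg _) hpos.le
  have hq : ∀ i, 0 ≤ q i := fun i => div_nonneg (negPart_nonneg _) hpos.le
  have hp1 := isProbabilityMeasure_mixtureMeasure hp
    (by rw [← Finset.sum_div, ← hs, div_self hpos.ne']) m
  have hq1 := isProbabilityMeasure_mixtureMeasure hq
    (by rw [← Finset.sum_div, hsum, div_self hpos.ne']) m
  have hpm : HasFiniteFirstMoment (mixtureMeasure p m) := fun x =>
    integrable_mixtureMeasure fun i => hm i x
  have hqm : HasFiniteFirstMoment (mixtureMeasure q m) := fun x =>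
    integrable_mixtureMeasure fun i => hm i x
  have h₁ := (hX _ _ hp1 hq1 hpm hqm).1
  have h₂ := (hX _ _ hq1 hp1 hqm hpm).1
  simp only [distEnergy_mixtureMeasure hm, hp, hq, implies_true] at h₁ h₂
  have hsq : ∑ i, ∑ j, c i * c j * distEnergy (m i) (m j) =
      s ^ 2 * (∑ i, ∑ j, p i * p j * distEnergy (m i) (m j)
        + ∑ i, ∑ j, q i * q j * distEnergy (m i) (m j)
        - ∑ i, ∑ j, p i * q j * distEnergy (m i) (m j)
        - ∑ i, ∑ j, q i * p j * distEnergy (m i) (m j)) := by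
    simp only [← Finset.sum_add_distrib, ← Finset.sum_sub_distrib, Finset.mul_sum]
    refine Finset.sum_congr rfl fun i _ => Finset.sum_congr rfl fun j _ => ?_
    have hs_pq : ∀ i, c i = s * (p i - q i) := fun i => by
      rw [← sub_div, mul_div_cancel₀ _ hpos.ne', ← hsplit]
    rw [hs_pq i, hs_pq j]
    ring
  rw [hsq]
  exact mul_nonpos_of_nonneg_of_nonpos (sq_nonneg s) (by linarith)

/-- In a space of strong negative type the negative of the doubly centred distance function is a
positive semidefinite kernel. -/
theorem HasStrongNegativeType.posSemidef_neg_centeredDist (hX : HasStrongNegativeType X)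
    {μ : Measure X} [IsProbabilityMeasure μ] (hμ : HasFiniteFirstMoment μ) :
    (Matrix.of fun x y => -centeredDist μ x y).PosSemidef := by
  refine ⟨?_, fun f => ?_⟩
  · ext x y
    simp only [Matrix.conjTranspose_apply, Matrix.of_apply, star_trivial, centeredDist,
      dist_comm x y]
    ring
  let m : Option f.support → Measure X := fun i => i.elim μ fun x => Measure.dirac x.1
  have hprob : ∀ i, IsProbabilityMeasure (m i) := by
    rintro (_ | x)
    · assumption
    · exact Measure.dirac.isProbabilityMeasure
  have hm : ∀ i, HasFiniteFirstMoment (m i) := by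
    rintro (_ | x)
    · exact hμ
    · exact hasFiniteFirstMoment_dirac x.1
  let c : Option f.support → ℝ := fun i => i.elim (-∑ x : f.support, f x) fun x => f x
  have hc : ∑ i, c i = 0 := by simp [Fintype.sum_option, c]
  have hstrong (x : X) (ρ : Measure X) [IsProbabilityMeasure ρ] (hρ : HasFiniteFirstMoment ρ) :
      distEnergy (Measure.dirac x) ρ = expectedDist ρ x :=
    integral_dirac' _ _ hρ.continuous_expectedDist.measurable.stronglyMeasurable
  have hdd (x y : X) : distEnergy (Measure.dirac x) (Measure.dirac y) = dist x y := by
    rw [hstrong x _ (hasFiniteFirstMoment_dirac y), expectedDist_dirac]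
  have hdm (x : X) : distEnergy (Measure.dirac x) μ = expectedDist μ x := hstrong x μ hμ
  have hmd (x : X) : distEnergy μ (Measure.dirac x) = expectedDist μ x := by
    rw [distEnergy_eq_integral_expectedDist, expectedDist]
    simp_rw [expectedDist_dirac, dist_comm]
  have key := hX.sum_mul_distEnergy_nonpos hm hc
  simp only [Fintype.sum_option, c, m, Option.elim, hdd, hdm, hmd] at key
  have hsum : (f.sum fun x a => f.sum fun y b =>
      star a * (Matrix.of fun x y => -centeredDist μ x y) x y * b) =
      ∑ x : f.support, ∑ y : f.support, -(f x * f y * centeredDist μ x y) := by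
    simp only [Finsupp.sum, star_trivial, Matrix.of_apply]
    rw [← Finset.sum_coe_sort f.support]
    refine Finset.sum_congr rfl fun x _ => ?_
    rw [← Finset.sum_coe_sort f.support]
    exact Finset.sum_congr rfl fun y _ => by ring
  rw [hsum]
  have hexp : ∑ x : f.support, ∑ y : f.support, -(f x * f y * centeredDist μ x y) =
      -(∑ x : f.support, ∑ y : f.support, f x * f y * dist (x : X) y)
      + 2 * ((∑ x : f.support, f x * expectedDist μ x) * ∑ x : f.support, f x)
      - (∑ x : f.support, f x) * (∑ x : f.support, f x) * distEnergy μ μ := by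
    have e₁ : (∑ x : f.support, f x * expectedDist μ x) * ∑ x : f.support, f x =
        ∑ x : f.support, ∑ y : f.support, f x * f y * expectedDist μ x := by
      rw [Finset.sum_mul_sum]
      exact Finset.sum_congr rfl fun x _ => Finset.sum_congr rfl fun y _ => by ring
    have e₂ : (∑ x : f.support, f x * expectedDist μ x) * ∑ x : f.support, f x =
        ∑ x : f.support, ∑ y : f.support, f x * f y * expectedDist μ y := by
      rw [e₁, Finset.sum_comm]
      exact Finset.sum_congr rfl fun x _ => Finset.sum_congr rfl fun y _ => by ring
    rw [two_mul]
    nth_rw 1 [e₁]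
    rw [e₂, Finset.sum_mul_sum]
    simp only [Finset.sum_mul _ _ (distEnergy μ μ), ← Finset.sum_neg_distrib,
      ← Finset.sum_add_distrib, ← Finset.sum_sub_distrib]
    refine Finset.sum_congr rfl fun x _ => Finset.sum_congr rfl fun y _ => ?_
    rw [centeredDist]
    ring
  rw [hexp]
  have h₁ (S : ℝ) : ∑ x : f.support, f x * (-S) * expectedDist μ x =
      -((∑ x : f.support, f x * expectedDist μ x) * S) := by
    rw [Finset.sum_mul, ← Finset.sum_neg_distrib]
    exact Finset.sum_congr rfl fun x _ => by ring
  have h₂ (S : ℝ) : ∑ x : f.support, (-S) * f x * expectedDist μ x =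
      -((∑ x : f.support, f x * expectedDist μ x) * S) := by
    simp_rw [mul_comm (-S), h₁]
  simp only [Finset.sum_add_distrib] at key
  rw [h₁, h₂] at key
  linarith

end NegativeType

section Independence

variable {X : Type*} [MetricSpace X] [MeasurableSpace X] [SecondCountableTopology X]

/-- In a space of strong negative type, a bounded density of total mass zero whose distance
potential is constant vanishes when pushed forward to the space. -/
theorem HasStrongNegativeType.setIntegral_eq_zero_of_potential_eq_const [OpensMeasurableSpace X]
    (hX : HasStrongNegativeType X) {Ω : Type*} [MeasurableSpace Ω] {θ : Measure Ω}
    [IsProbabilityMeasure θ] {φ : Ω → X} (hφ : Measurable φ)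
    (hfm : HasFiniteFirstMoment (θ.map φ)) {b : Ω → ℝ} (hb : Measurable b) {M : ℝ}
    (hM : ∀ ω, |b ω| ≤ M) (hb0 : ∫ ω, b ω ∂θ = 0) {C : ℝ}
    (hC : ∀ x, ∫ ω, dist x (φ ω) * b ω ∂θ = C) {s : Set X} (hs : MeasurableSet s) :
    ∫ ω in φ ⁻¹' s, b ω ∂θ = 0 := by
  have hM0 : 0 ≤ M := by
    obtain ⟨ω⟩ : Nonempty Ω := θ.nonempty_of_neZero
    exact (abs_nonneg _).trans (hM ω)
  set N := M + 1
  have hN0 : 0 < N := by positivity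
  have hbi : Integrable b θ :=
    (integrable_const M).mono' hb.aestronglyMeasurable (Filter.Eventually.of_forall hM)
  have hg0 : ∀ ω, 0 ≤ 1 + b ω / N := fun ω => by
    have h₁ := (abs_le.mp (hM ω)).1
    have : -1 ≤ b ω / N := by rw [le_div_iff₀ hN0]; linarith
    linarith
  let g : Ω → NNReal := fun ω => (1 + b ω / N).toNNReal
  have hg : Measurable g := (measurable_const.add (hb.div_const N)).real_toNNReal
  have hgi : Integrable (fun ω => 1 + b ω / N) θ := (integrable_const 1).add (hbi.div_const N)
  let ρ : Measure X := (θ.withDensity fun ω => (g ω : ENNReal)).map φ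
  set μ := θ.map φ with hμ
  have hμp : IsProbabilityMeasure μ := Measure.isProbabilityMeasure_map hφ.aemeasurable
  have hρp : IsProbabilityMeasure ρ := by
    have : IsProbabilityMeasure (θ.withDensity fun ω => (g ω : ENNReal)) := by
      constructor
      rw [withDensity_apply _ MeasurableSet.univ, Measure.restrict_univ]
      change ∫⁻ ω, ENNReal.ofReal (1 + b ω / N) ∂θ = 1
      rw [← ofReal_integral_eq_lintegral_ofReal hgi (Filter.Eventually.of_forall hg0),
        integral_add (integrable_const 1) (hbi.div_const N), integral_div, hb0]
      simp
    exact Measure.isProbabilityMeasure_map hφ.aemeasurable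
  have hdc : ∀ x : X, Continuous fun y => dist x y := fun x => continuous_const.dist continuous_id
  have hdφ : ∀ x, Integrable (fun ω => dist x (φ ω)) θ := fun x =>
    (integrable_map_measure (hdc x).measurable.aestronglyMeasurable hφ.aemeasurable).mp (hfm x)
  have hdb : ∀ x, Integrable (fun ω => dist x (φ ω) * b ω) θ := fun x =>
    (hdφ x).mul_bdd (c := M) hb.aestronglyMeasurable (Filter.Eventually.of_forall hM)
  have hexpand : ∀ x ω, g ω • dist x (φ ω) = dist x (φ ω) + dist x (φ ω) * b ω / N :=
    fun x ω => by
      rw [NNReal.smul_def, Real.coe_toNNReal _ (hg0 ω), smul_eq_mul]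
      ring
  have hρm : HasFiniteFirstMoment ρ := fun x => by
    rw [integrable_map_measure (hdc x).measurable.aestronglyMeasurable hφ.aemeasurable,
      integrable_withDensity_iff_integrable_smul hg]
    simp only [Function.comp_apply, hexpand]
    exact (hdφ x).add ((hdb x).div_const N)
  have hpot : ∀ x, expectedDist ρ x = expectedDist μ x + C / N := fun x => by
    rw [expectedDist, integral_map hφ.aemeasurable (hdc x).measurable.aestronglyMeasurable,
      integral_withDensity_eq_integral_smul hg, expectedDist, hμ,
      integral_map hφ.aemeasurable (hdc x).measurable.aestronglyMeasurable]
    simp only [hexpand]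
    rw [integral_add (hdφ x) ((hdb x).div_const N), integral_div, hC]
  have hμρ : distEnergy μ ρ = distEnergy μ μ + C / N := by
    simp_rw [distEnergy_eq_integral_expectedDist, hpot]
    rw [integral_add (hfm.integrable_expectedDist hfm) (integrable_const _)]
    simp
  have hρρ : distEnergy ρ ρ = distEnergy μ ρ + C / N := by
    rw [← hρm.distEnergy_comm hfm]
    simp_rw [distEnergy_eq_integral_expectedDist, hpot]
    rw [integral_add (hfm.integrable_expectedDist hρm) (integrable_const _)]
    simp
  have heq : μ = ρ := (hX μ ρ hμp hρp hfm hρm).2.mp (by rw [hρρ, hμρ]; ring)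
  have hsφ := hφ hs
  have hset : θ.real (φ ⁻¹' s) = ∫ ω in φ ⁻¹' s, (1 + b ω / N) ∂θ := by
    rw [integral_eq_lintegral_of_nonneg_ae (Filter.Eventually.of_forall hg0)
      hgi.aestronglyMeasurable.restrict, Measure.real, ← Measure.map_apply hφ hs, ← hμ, heq,
      Measure.map_apply hφ hs, withDensity_apply _ hsφ]
    rfl
  rw [integral_add (integrable_const 1).integrableOn (hbi.div_const N).integrableOn,
    integral_div] at hset
  simpa [hN0.ne'] using hset

end Independence

section DistanceCovariance

variable {X Y : Type*} [MetricSpace X] [MetricSpace Y] [SecondCountableTopology X]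
  [SecondCountableTopology Y] [MeasurableSpace X] [BorelSpace X] [MeasurableSpace Y] [BorelSpace Y]
  {θ : Measure (X × Y)} [IsProbabilityMeasure θ]

/-- If the distance covariance vanishes, so does the potential of the product of the doubly centred
distance functions. -/
theorem integral_centeredDist_mul_eq_zero (hX : HasStrongNegativeType X)
    (hY : HasStrongNegativeType Y) (hμ : HasFiniteFirstMoment (θ.map Prod.fst))
    (hν : HasFiniteFirstMoment (θ.map Prod.snd))
    (hdcov : ∫ w, ∫ w', centeredDist (θ.map Prod.fst) w.1 w'.1 *
      centeredDist (θ.map Prod.snd) w.2 w'.2 ∂θ ∂θ = 0) (x : X) (y : Y) :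
    ∫ w, centeredDist (θ.map Prod.fst) w.1 x * centeredDist (θ.map Prod.snd) w.2 y ∂θ = 0 := by
  set μ := θ.map Prod.fst
  set ν := θ.map Prod.snd
  have hμp : IsProbabilityMeasure μ := Measure.isProbabilityMeasure_map measurable_fst.aemeasurable
  have hνp : IsProbabilityMeasure ν := Measure.isProbabilityMeasure_map measurable_snd.aemeasurable
  have hA := hX.posSemidef_neg_centeredDist hμ
  have hB := hY.posSemidef_neg_centeredDist hν
  have hAc := hμ.continuous_centeredDist
  have hBc := hν.continuous_centeredDist
  have hAd : ∀ x, 0 ≤ -centeredDist μ x x := fun x => hA.diag_nonneg (i := x)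
  have hBd : ∀ y, 0 ≤ -centeredDist ν y y := fun y => hB.diag_nonneg (i := y)
  have hAi : Integrable (fun w : X × Y => -centeredDist μ w.1 w.1) θ := by
    have : Integrable (fun x => -centeredDist μ x x) μ := by
      simp only [centeredDist, dist_self]
      have := hμ.integrable_expectedDist hμ
      fun_prop
    exact this.comp_measurable measurable_fst
  have hBi : Integrable (fun w : X × Y => -centeredDist ν w.2 w.2) θ := by
    have : Integrable (fun y => -centeredDist ν y y) ν := by
      simp only [centeredDist, dist_self]
      have := hν.integrable_expectedDist hν
      fun_prop
    exact this.comp_measurable measurable_snd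
  have hK : (Matrix.of fun w w' : X × Y =>
      centeredDist μ w.1 w'.1 * centeredDist ν w.2 w'.2).PosSemidef := by
    have := (hA.submatrix (Prod.fst : X × Y → X)).hadamard (hB.submatrix (Prod.snd : X × Y → Y))
    refine (congrArg Matrix.PosSemidef ?_).mp this
    ext w w'
    exact neg_mul_neg _ _
  have hKc : Continuous fun p : (X × Y) × (X × Y) =>
      centeredDist μ p.1.1 p.2.1 * centeredDist ν p.1.2 p.2.2 :=
    (hAc.comp (by fun_prop : Continuous fun p : (X × Y) × (X × Y) => (p.1.1, p.2.1))).mul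
      (hBc.comp (by fun_prop : Continuous fun p : (X × Y) × (X × Y) => (p.1.2, p.2.2)))
  refine hK.integral_eq_zero_of_energy_eq_zero hKc ?_ hdcov (x, y)
  refine (hAi.add hBi).mono' ?_ (Filter.Eventually.of_forall fun w => ?_)
  · exact (Real.continuous_sqrt.comp
      (hKc.comp (continuous_id.prodMk continuous_id))).measurable.aestronglyMeasurable
  · rw [Real.norm_of_nonneg (Real.sqrt_nonneg _)]
    simp only [Matrix.of_apply, Pi.add_apply]
    have h₁ := hAd w.1
    have h₂ := hBd w.2
    rw [Real.sqrt_le_left (by positivity)]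
    nlinarith [mul_nonneg h₁ h₂, sq_nonneg (centeredDist μ w.1 w.1),
      sq_nonneg (centeredDist ν w.2 w.2)]

/-- A probability measure on a product of spaces of strong negative type whose distance covariance
vanishes is the product of its marginals. -/
theorem eq_prod_of_integral_centeredDist_mul_eq_zero (hX : HasStrongNegativeType X)
    (hY : HasStrongNegativeType Y) (hμ : HasFiniteFirstMoment (θ.map Prod.fst))
    (hν : HasFiniteFirstMoment (θ.map Prod.snd))
    (hdcov : ∫ w, ∫ w', centeredDist (θ.map Prod.fst) w.1 w'.1 *
      centeredDist (θ.map Prod.snd) w.2 w'.2 ∂θ ∂θ = 0) :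
    θ = (θ.map Prod.fst).prod (θ.map Prod.snd) := by
  have hpot := integral_centeredDist_mul_eq_zero hX hY hμ hν hdcov
  set μ := θ.map Prod.fst with hμ'
  set ν := θ.map Prod.snd with hν'
  have hμp : IsProbabilityMeasure μ := Measure.isProbabilityMeasure_map measurable_fst.aemeasurable
  have hνp : IsProbabilityMeasure ν := Measure.isProbabilityMeasure_map measurable_snd.aemeasurable
  have hBm (y : Y) : Measurable fun y' => centeredDist ν y' y :=
    (hν.continuous_centeredDist.comp (continuous_id.prodMk continuous_const)).measurable
  have hX0 (s : Set X) (hs : MeasurableSet s) (y : Y) :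
      ∫ w in Prod.fst ⁻¹' s, centeredDist ν w.2 y ∂θ = 0 := by
    have hm : Measurable fun w : X × Y => centeredDist ν w.2 y := (hBm y).comp measurable_snd
    have hbi : Integrable (fun w : X × Y => centeredDist ν w.2 y) θ :=
      (integrable_const _).mono' hm.aestronglyMeasurable
        (Filter.Eventually.of_forall fun w => hν.abs_centeredDist_le w.2 y)
    have hb0 : ∫ w, centeredDist ν w.2 y ∂θ = 0 := by
      rw [← hν.integral_centeredDist y, hν',
        integral_map measurable_snd.aemeasurable (hBm y).aestronglyMeasurable]
    have hd (x : X) : Integrable (fun w : X × Y => dist x w.1 * centeredDist ν w.2 y) θ :=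
      ((hμ x).comp_measurable measurable_fst).mul_bdd hm.aestronglyMeasurable
        (Filter.Eventually.of_forall fun w => hν.abs_centeredDist_le w.2 y)
    have ha : Integrable (fun w : X × Y => expectedDist μ w.1 * centeredDist ν w.2 y) θ :=
      ((hμ.integrable_expectedDist hμ).comp_measurable measurable_fst).mul_bdd
        hm.aestronglyMeasurable
        (Filter.Eventually.of_forall fun w => hν.abs_centeredDist_le w.2 y)
    refine hX.setIntegral_eq_zero_of_potential_eq_const measurable_fst hμ hm
      (fun w => hν.abs_centeredDist_le w.2 y) hb0
      (C := ∫ w, expectedDist μ w.1 * centeredDist ν w.2 y ∂θ) (fun x => ?_) hs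
    have hsplit : ∀ w : X × Y, centeredDist μ w.1 x * centeredDist ν w.2 y =
        dist x w.1 * centeredDist ν w.2 y - expectedDist μ w.1 * centeredDist ν w.2 y
          + (distEnergy μ μ - expectedDist μ x) * centeredDist ν w.2 y := fun w => by
      rw [centeredDist, dist_comm w.1 x]
      ring
    have h := hpot x y
    simp_rw [hsplit] at h
    have hda : Integrable (fun w : X × Y => dist x w.1 * centeredDist ν w.2 y -
        expectedDist μ w.1 * centeredDist ν w.2 y) θ := (hd x).sub ha
    rw [integral_add hda (hbi.const_mul _), integral_sub (hd x) ha,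
      integral_const_mul, hb0] at h
    linarith
  refine (Measure.prod_eq fun s t hs ht => ?_).symm
  have hsθ : MeasurableSet (Prod.fst ⁻¹' s : Set (X × Y)) := measurable_fst hs
  have htθ : MeasurableSet (Prod.snd ⁻¹' t : Set (X × Y)) := measurable_snd ht
  let b : X × Y → ℝ := fun w => (Prod.fst ⁻¹' s).indicator 1 w - μ.real s
  have hbm : Measurable b := (measurable_one.indicator hsθ).sub_const _
  have hμs : θ.real (Prod.fst ⁻¹' s) = μ.real s := by
    rw [hμ', map_measureReal_apply measurable_fst hs]
  have hνt : θ.real (Prod.snd ⁻¹' t) = ν.real t := by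
    rw [hν', map_measureReal_apply measurable_snd ht]
  have hone : Integrable ((Prod.fst ⁻¹' s : Set (X × Y)).indicator (1 : X × Y → ℝ)) θ :=
    (integrable_const 1).indicator hsθ
  have hb0 : ∫ w, b w ∂θ = 0 := by
    simp only [b]
    rw [integral_sub hone (integrable_const _), integral_indicator_one hsθ, hμs]
    simp
  have hb1 : ∀ w, |b w| ≤ 1 := fun w => by
    have h₁ : μ.real s ≤ 1 := measureReal_le_one
    have h₂ : 0 ≤ μ.real s := measureReal_nonneg
    by_cases hw : w ∈ (Prod.fst ⁻¹' s : Set (X × Y)) <;>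
      simp only [b, hw, Set.indicator_of_mem, Set.indicator_of_notMem, not_false_eq_true,
        Pi.one_apply, abs_le] <;> constructor <;> linarith
  have hd (y : Y) : Integrable (fun w : X × Y => dist y w.2) θ :=
    (hν y).comp_measurable measurable_snd
  have ha : Integrable (fun w : X × Y => expectedDist ν w.2) θ :=
    (hν.integrable_expectedDist hν).comp_measurable measurable_snd
  have hY0 := hY.setIntegral_eq_zero_of_potential_eq_const measurable_snd hν hbm hb1 hb0
    (C := ∫ w in Prod.fst ⁻¹' s, expectedDist ν w.2 ∂θ - μ.real s * distEnergy ν ν)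
    (fun y => ?_) ht
  · simp only [b] at hY0
    rw [integral_sub hone.integrableOn (integrable_const _).integrableOn,
      integral_indicator_one hsθ, setIntegral_const, measureReal_restrict_apply hsθ, hνt,
      smul_eq_mul, sub_eq_zero, ← Set.prod_eq] at hY0
    rw [← ENNReal.toReal_eq_toReal_iff' (measure_ne_top _ _)
      (ENNReal.mul_ne_top (measure_ne_top _ _) (measure_ne_top _ _)), ENNReal.toReal_mul]
    rw [mul_comm] at hY0
    exact hY0
  · have h := hX0 s hs y
    have hdy : ∫ w, dist y w.2 ∂θ = expectedDist ν y := by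
      rw [expectedDist, hν', integral_map measurable_snd.aemeasurable
        (by fun_prop : Continuous fun y' => dist y y').measurable.aestronglyMeasurable]
    have hrw : ∀ w : X × Y, dist y w.2 * b w =
        (Prod.fst ⁻¹' s).indicator (fun w => dist y w.2) w - μ.real s * dist y w.2 := fun w => by
      by_cases hw : w ∈ (Prod.fst ⁻¹' s : Set (X × Y)) <;>
        simp only [b, hw, Set.indicator_of_mem, Set.indicator_of_notMem, not_false_eq_true,
          Pi.one_apply] <;> ring
    simp_rw [hrw]
    rw [integral_sub ((hd y).indicator hsθ) ((hd y).const_mul _), integral_indicator hsθ,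
      integral_const_mul, hdy]
    simp only [centeredDist, dist_comm _ y] at h
    have hda : Integrable (fun w : X × Y => dist y w.2 - expectedDist ν w.2) θ := (hd y).sub ha
    have hdac : Integrable (fun w : X × Y => dist y w.2 - expectedDist ν w.2 - expectedDist ν y) θ :=
      hda.sub (integrable_const _)
    rw [integral_add hdac.integrableOn (integrable_const _).integrableOn,
      integral_sub hda.integrableOn (integrable_const _).integrableOn,
      integral_sub (hd y).integrableOn ha.integrableOn, setIntegral_const, setIntegral_const, hμs,
      smul_eq_mul, smul_eq_mul] at h
    linarith

end DistanceCovariance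

theorem dcov_zero_implies_independent_of_strong_negative_type
    {X Y : Type*} [MetricSpace X] [MetricSpace Y]
    [TopologicalSpace.SeparableSpace X] [TopologicalSpace.SeparableSpace Y]
    [MeasurableSpace X] [BorelSpace X] [MeasurableSpace Y] [BorelSpace Y]
    (hX : ∀ ρ₁ ρ₂ : Measure X, IsProbabilityMeasure ρ₁ → IsProbabilityMeasure ρ₂ →
      (∀ x : X, Integrable (fun y => dist x y) ρ₁) →
      (∀ x : X, Integrable (fun y => dist x y) ρ₂) →
      0 ≤ 2 * (∫ x, ∫ y, dist x y ∂ρ₂ ∂ρ₁)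
          - (∫ x, ∫ y, dist x y ∂ρ₁ ∂ρ₁) - (∫ x, ∫ y, dist x y ∂ρ₂ ∂ρ₂) ∧
        (2 * (∫ x, ∫ y, dist x y ∂ρ₂ ∂ρ₁)
          - (∫ x, ∫ y, dist x y ∂ρ₁ ∂ρ₁) - (∫ x, ∫ y, dist x y ∂ρ₂ ∂ρ₂) = 0 ↔ ρ₁ = ρ₂))
    (hY : ∀ ρ₁ ρ₂ : Measure Y, IsProbabilityMeasure ρ₁ → IsProbabilityMeasure ρ₂ →
      (∀ x : Y, Integrable (fun y => dist x y) ρ₁) →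
      (∀ x : Y, Integrable (fun y => dist x y) ρ₂) →
      0 ≤ 2 * (∫ x, ∫ y, dist x y ∂ρ₂ ∂ρ₁)
          - (∫ x, ∫ y, dist x y ∂ρ₁ ∂ρ₁) - (∫ x, ∫ y, dist x y ∂ρ₂ ∂ρ₂) ∧
        (2 * (∫ x, ∫ y, dist x y ∂ρ₂ ∂ρ₁)
          - (∫ x, ∫ y, dist x y ∂ρ₁ ∂ρ₁) - (∫ x, ∫ y, dist x y ∂ρ₂ ∂ρ₂) = 0 ↔ ρ₁ = ρ₂))
    (θ : Measure (X × Y)) [IsProbabilityMeasure θ]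
    (μ : Measure X) (ν : Measure Y)
    (hμ : μ = θ.map Prod.fst) (hν : ν = θ.map Prod.snd)
    (hμfm : ∀ x : X, Integrable (fun y => dist x y) μ)
    (hνfm : ∀ y : Y, Integrable (fun y' => dist y y') ν)
    (hμ2 : Integrable (fun q : X × X => dist q.1 q.2) (μ.prod μ))
    (hν2 : Integrable (fun q : Y × Y => dist q.1 q.2) (ν.prod ν))
    (hθ2 : Integrable (fun w : (X × Y) × (X × Y) =>
        (dist w.1.1 w.2.1 - (∫ y, dist w.1.1 y ∂μ) - (∫ y, dist w.2.1 y ∂μ)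
            + ∫ z, ∫ y, dist z y ∂μ ∂μ)
          * (dist w.1.2 w.2.2 - (∫ y, dist w.1.2 y ∂ν) - (∫ y, dist w.2.2 y ∂ν)
            + ∫ z, ∫ y, dist z y ∂ν ∂ν)) (θ.prod θ))
    (hdcov : (∫ w, ∫ w',
        (dist w.1 w'.1 - (∫ y, dist w.1 y ∂μ) - (∫ y, dist w'.1 y ∂μ)
            + ∫ z, ∫ y, dist z y ∂μ ∂μ)
          * (dist w.2 w'.2 - (∫ y, dist w.2 y ∂ν) - (∫ y, dist w'.2 y ∂ν)
            + ∫ z, ∫ y, dist z y ∂ν ∂ν)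
        ∂θ ∂θ) = 0) :
    θ = μ.prod ν := by
  have := UniformSpace.secondCountable_of_separable X
  have := UniformSpace.secondCountable_of_separable Y
  subst hμ hν
  exact eq_prod_of_integral_centeredDist_mul_eq_zero hX hY hμfm hνfm hdcov
end
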